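/- For all integers k ≥ 2 and j ≥ 0, there exist derivations θ_1, …, θ_{k+1} ∈ D_0(f_{j,k}), each homogeneous of degree 2k+1+3j, and a (k+1)×(k−1) matrix M with entries in S all of which are homogeneous linear forms, such that: (a) the S-linear map Φ : S^{k+1} → Der_ℝ(S) sending (a_1,…,a_{k+1}) to Σ_i a_i·θ_i has image exactly D_0(f_{j,k}); (b) the S-linear map Ψ : S^{k−1} → S^{k+1}, v ↦ M·v, is injective; and (c) the image of Ψ equals the kernel of Φ. (Equivalently, there is an exact sequence 0 → S(−1)^{k−1} → S^{k+1} → D_0(f_{j,k})(2k+1+3j) → 0 of graded S-modules; i.e., the logarithmic bundle T_A(2k+1+3j) of the arrangement A = A_{A2}^{[−j,k+j]} is a Steiner bundle.) -/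

import Mathlib

open MvPolynomial

noncomputable section

abbrev S := MvPolynomial (Fin 3) ℝ

/-- The module of logarithmic derivations annihilating `f`. -/
def D0 (f : S) : Submodule S (Derivation ℝ S S) where
  carrier := {θ | θ f = 0}
  add_mem' := by
    intro a b ha hb
    simp only [Set.mem_setOf_eq] at *
    simp [ha, hb]
  zero_mem' := by simp
  smul_mem' := by
    intro c θ hθ
    simp only [Set.mem_setOf_eq] at *
    simp [hθ]

/-- Defining polynomial of the cone over `A_{A2}^{[-j, k+j]}`. -/
def fjk (j k : ℕ) : S :=
  X 2 * ∏ s ∈ Finset.Icc (-(j : ℤ)) ((k : ℤ) + j),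
    ((X 0 - C (s : ℝ) * X 2) * (X 1 - C (s : ℝ) * X 2) * (X 0 + X 1 - C (s : ℝ) * X 2))

/-- A derivation is homogeneous of degree `d` if its values on the variables are
homogeneous of degree `d`. -/
def IsHomogDer (θ : Derivation ℝ S S) (d : ℕ) : Prop :=
  ∀ i : Fin 3, (θ (X i)).IsHomogeneous d

/-! ### Falling factorials and the umbral map -/

/-- Homogenised falling factorial `u (u - ε) ⋯ (u - (i-1) ε)`. -/
def ff (ε u : S) (i : ℕ) : S := ∏ s ∈ Finset.range i, (u - (s : S) * ε)

lemma ff_zero (ε u : S) : ff ε u 0 = 1 := by simp [ff]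

lemma ff_succ (ε u : S) (i : ℕ) : ff ε u (i + 1) = ff ε u i * (u - (i : S) * ε) := by
  simp [ff, Finset.prod_range_succ]

lemma ff_add (ε u : S) (i l : ℕ) :
    ff ε u (i + l) = ff ε u i * ff ε (u - (i : S) * ε) l := by
  simp only [ff, Finset.prod_range_add]
  congr 1
  apply Finset.prod_congr rfl
  intro s _
  push_cast
  ring

lemma ff_hom {ε u : S} (hε : ε.IsHomogeneous 1) (hu : u.IsHomogeneous 1) (i : ℕ) :
    (ff ε u i).IsHomogeneous i := by
  have := IsHomogeneous.prod (Finset.range i) (fun s : ℕ => u - (s : S) * ε) (fun _ => 1) (by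
    intro s _
    apply hu.sub
    have h := hε.C_mul (s : ℝ)
    simpa using h)
  simpa [ff] using this

/-- The umbral map: `∑ f_i t^i ↦ ∑ f_i u^{(i)} v^{(N-i)}`. -/
def lum (ε u v : S) (N : ℕ) (f : Polynomial ℝ) : S :=
  ∑ i ∈ Finset.range (N + 1), C (f.coeff i) * (ff ε u i * ff ε v (N - i))

lemma lum_add (ε u v : S) (N : ℕ) (f g : Polynomial ℝ) :
    lum ε u v N (f + g) = lum ε u v N f + lum ε u v N g := by
  simp [lum, add_mul, Finset.sum_add_distrib]

lemma lum_hom {ε u v : S} (hε : ε.IsHomogeneous 1) (hu : u.IsHomogeneous 1)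
    (hv : v.IsHomogeneous 1) (N : ℕ) (f : Polynomial ℝ) : (lum ε u v N f).IsHomogeneous N := by
  apply IsHomogeneous.sum
  intro i hi
  apply IsHomogeneous.C_mul
  have := (ff_hom hε hu i).mul (ff_hom hε hv (N - i))
  have h2 : i + (N - i) = N := by
    have := Finset.mem_range.1 hi
    omega
  rwa [h2] at this

lemma lum_step (ε u v : S) (N : ℕ) (f : Polynomial ℝ) (hf : f.natDegree ≤ N) :
    lum ε u v (N + 1) (f * (1 + Polynomial.X)) = lum ε u v N f * (u + v - (N : S) * ε) := by
  rw [mul_add, mul_one, lum_add]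
  have h1 : lum ε u v (N + 1) f =
      ∑ i ∈ Finset.range (N + 1), C (f.coeff i) * (ff ε u i * ff ε v (N + 1 - i)) := by
    rw [lum, Finset.sum_range_succ]
    rw [Polynomial.coeff_eq_zero_of_natDegree_lt (by omega)]
    simp
  have h2 : lum ε u v (N + 1) (f * Polynomial.X) =
      ∑ i ∈ Finset.range (N + 1), C (f.coeff i) * (ff ε u (i + 1) * ff ε v (N - i)) := by
    rw [lum, Finset.sum_range_succ']
    simp
  rw [h1, h2, ← Finset.sum_add_distrib, lum, Finset.sum_mul]
  apply Finset.sum_congr rfl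
  intro i hi
  have hi' : i ≤ N := by
    have := Finset.mem_range.1 hi
    omega
  have e1 : N + 1 - i = (N - i) + 1 := by omega
  rw [e1, ff_succ, ff_succ]
  push_cast [hi']
  ring

lemma lum_pow (ε u v : S) (N m : ℕ) (f : Polynomial ℝ) (hf : f.natDegree ≤ N) :
    lum ε u v (N + m) (f * (1 + Polynomial.X) ^ m) =
      lum ε u v N f * ff ε (u + v - (N : S) * ε) m := by
  induction m with
  | zero => simp [ff_zero]
  | succ m ih =>
    have hd : (f * (1 + Polynomial.X) ^ m).natDegree ≤ N + m := by
      refine Polynomial.natDegree_mul_le.trans ?_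
      have h1 : ((1 + Polynomial.X : Polynomial ℝ) ^ m).natDegree ≤ m := by
        refine Polynomial.natDegree_pow_le.trans ?_
        have : (1 + Polynomial.X : Polynomial ℝ).natDegree ≤ 1 := by
          rw [add_comm]
          exact (Polynomial.natDegree_X_add_C (1 : ℝ)).le
        nlinarith
      omega
    rw [pow_succ, ← mul_assoc, ← add_assoc, lum_step _ _ _ _ _ hd, ih, ff_succ]
    push_cast
    ring

lemma lum_low (ε u v : S) (n m : ℕ) (f : Polynomial ℝ) (hf : f.natDegree ≤ n) :
    lum ε u v (n + m) f = lum ε u (v - (m : S) * ε) n f * ff ε v m := by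
  rw [lum, lum, Finset.sum_mul]
  have : n + m + 1 = (n + 1) + m := by ring
  rw [this, Finset.sum_range_add]
  rw [Finset.sum_eq_zero (s := Finset.range m), add_zero]
  · apply Finset.sum_congr rfl
    intro i hi
    have hi' := Finset.mem_range.1 hi
    have e : n + m - i = m + (n - i) := by omega
    rw [e, ff_add]
    ring
  · intro i _
    rw [Polynomial.coeff_eq_zero_of_natDegree_lt (by omega)]
    simp

lemma lum_high (ε u v : S) (n m : ℕ) (f : Polynomial ℝ) :
    lum ε u v (n + m) (f * Polynomial.X ^ m) = lum ε (u - (m : S) * ε) v n f * ff ε u m := by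
  rw [lum, lum, Finset.sum_mul]
  have : n + m + 1 = m + (n + 1) := by ring
  rw [this, Finset.sum_range_add]
  rw [Finset.sum_eq_zero (s := Finset.range m), zero_add]
  · apply Finset.sum_congr rfl
    intro i hi
    have hi' := Finset.mem_range.1 hi
    have e : n + m - (m + i) = n - i := by omega
    rw [e, ff_add, Polynomial.coeff_mul_X_pow', if_pos (by omega)]
    rw [Nat.add_sub_cancel_left]
    ring
  · intro i hi
    have hi' := Finset.mem_range.1 hi
    rw [Polynomial.coeff_mul_X_pow', if_neg (by omega)]
    simp

/-! ### Dehomogenisation on the line at infinity -/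

/-- `x ↦ t`, `y ↦ 1`, `z ↦ 0`. -/
def dl : S →ₐ[ℝ] Polynomial ℝ := aeval ![Polynomial.X, 1, 0]

@[simp] lemma dl_X0 : dl (X 0) = Polynomial.X := by simp [dl]
@[simp] lemma dl_X1 : dl (X 1) = 1 := by simp [dl]
@[simp] lemma dl_X2 : dl (X 2) = 0 := by simp [dl]
@[simp] lemma dl_C (r : ℝ) : dl (C r) = Polynomial.C r := by
  simp [dl]

lemma dl_ff {ε u : S} (hε : dl ε = 0) (i : ℕ) : dl (ff ε u i) = (dl u) ^ i := by
  simp [ff, map_prod, hε]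

lemma dl_lum {ε u v : S} (hε : dl ε = 0) (hu : dl u = Polynomial.X) (hv : dl v = 1)
    (N : ℕ) (f : Polynomial ℝ) (hf : f.natDegree ≤ N) : dl (lum ε u v N f) = f := by
  simp only [lum, map_sum, map_mul, dl_C, dl_ff hε, hu, hv, one_pow, mul_one]
  exact (f.as_sum_range_C_mul_X_pow' (by omega)).symm

lemma eval_smul_hom {σ : Type*} {f : MvPolynomial σ ℝ} {d : ℕ} (hf : f.IsHomogeneous d)
    (r : ℝ) (p : σ → ℝ) : eval (fun i => r * p i) f = r ^ d * eval p f := by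
  rw [eval_eq, eval_eq, Finset.mul_sum]
  apply Finset.sum_congr rfl
  intro s hs
  have h := hf.degree_eq_sum_deg_support hs
  simp only [mul_pow, Finset.prod_mul_distrib]
  rw [Finset.prod_pow_eq_pow_sum]
  rw [h]
  ring

/-- Substituting `g` for the variable `i`. -/
def sb (i : Fin 3) (g : S) : S →ₐ[ℝ] S := aeval (Function.update X i g)

lemma sb_dvd (i : Fin 3) (g f : S) : X i - g ∣ f - sb i g f := by
  induction f using MvPolynomial.induction_on with
  | C a => simp [sb]
  | add p q hp hq =>
    have : p + q - sb i g (p + q) = (p - sb i g p) + (q - sb i g q) := by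
      rw [map_add]; ring
    rw [this]
    exact dvd_add hp hq
  | mul_X p j hp =>
    have : p * X j - sb i g (p * X j) = (p - sb i g p) * X j + sb i g p * (X j - sb i g (X j)) := by
      rw [map_mul]; ring
    rw [this]
    apply dvd_add (Dvd.dvd.mul_right hp _)
    apply Dvd.dvd.mul_left
    by_cases h : j = i
    · subst h; simp [sb]
    · simp [sb, Function.update_of_ne h]

lemma dvd_of_sb {i : Fin 3} {g f : S} (h : sb i g f = 0) : X i - g ∣ f := by
  have := sb_dvd i g f
  rwa [h, sub_zero] at this

lemma sb_of_dvd {i : Fin 3} {g f l : S} (hg : sb i g l = 0) (h : l ∣ f) : sb i g f = 0 := by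
  obtain ⟨q, rfl⟩ := h
  rw [map_mul, hg, zero_mul]

lemma sb_X_self (i : Fin 3) (g : S) : sb i g (X i) = g := by simp [sb]
lemma sb_X_ne {i j : Fin 3} (h : j ≠ i) (g : S) : sb i g (X j) = X j := by
  simp [sb, Function.update_of_ne h]
lemma sb_C (i : Fin 3) (g : S) (r : ℝ) : sb i g (C r) = C r := by simp [sb]

/-- A homogeneous polynomial killed by `dl` is divisible by `z`. -/
lemma X2_dvd_of_dl {f : S} {d : ℕ} (hf : f.IsHomogeneous d) (h : dl f = 0) : X 2 ∣ f := by
  have key : sb 2 0 f = 0 := by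
    have h1 : X 1 * sb 2 0 f = 0 := by
      apply MvPolynomial.funext
      intro p
      rw [map_mul, map_zero, eval_X]
      by_cases hp : p 1 = 0
      · simp [hp]
      · have e1 : eval p (sb 2 0 f) = eval (fun i => p 1 * (![p 0 / p 1, 1, 0] : Fin 3 → ℝ) i) f := by
          have : eval p (sb 2 0 f) = eval (fun i => eval p (Function.update X 2 0 i)) f := by
            have : (eval p).comp (sb 2 0).toRingHom =
                eval (fun i => eval p (Function.update X 2 0 i)) := by
              apply MvPolynomial.ringHom_ext
              · intro r; simp [sb]
              · intro i; simp [sb]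
            exact RingHom.congr_fun this f
          rw [this]
          congr 2
          funext i
          fin_cases i
          · simp [Function.update]; field_simp
          · simp [Function.update]
          · simp [Function.update]
        have e2 : eval (![p 0 / p 1, 1, 0] : Fin 3 → ℝ) f = (dl f).eval (p 0 / p 1) := by
          have : ((Polynomial.evalRingHom (p 0 / p 1)).comp dl.toRingHom) =
              eval (![p 0 / p 1, 1, 0] : Fin 3 → ℝ) := by
            apply MvPolynomial.ringHom_ext
            · intro r; simp
            · intro i; fin_cases i <;> simp
          exact (RingHom.congr_fun this f).symm
        rw [e1, eval_smul_hom hf, e2, h]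
        simp
    exact (mul_eq_zero.1 h1).resolve_left (X_ne_zero _)
  simpa using dvd_of_sb key
/-! ### Homogeneous components -/

lemma comp_mul {G : S} {m : ℕ} (hG : G.IsHomogeneous m) (a : S) (d : ℕ) :
    homogeneousComponent (d + m) (a * G) = homogeneousComponent d a * G := by
  conv_lhs => rw [← sum_homogeneousComponent a, Finset.sum_mul, map_sum]
  have h : ∀ e ∈ Finset.range (a.totalDegree + 1),
      homogeneousComponent (d + m) (homogeneousComponent e a * G) =
        if e = d then homogeneousComponent d a * G else 0 := by
    intro e _
    have h1 : (homogeneousComponent e a * G) ∈ homogeneousSubmodule (Fin 3) ℝ (e + m) :=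
      (homogeneousComponent_isHomogeneous e a).mul hG
    rw [homogeneousComponent_of_mem h1]
    by_cases he : e = d
    · subst he; simp
    · rw [if_neg (by omega), if_neg he]
  rw [Finset.sum_congr rfl h, Finset.sum_ite_eq']
  split_ifs with hd
  · rfl
  · have hd' : a.totalDegree < d := by
      rw [Finset.mem_range] at hd
      omega
    rw [homogeneousComponent_eq_zero _ _ hd', zero_mul]

lemma hom_div {f : S} {d : ℕ} (hf : f.IsHomogeneous (d + 1)) (h : dl f = 0) :
    ∃ g : S, g.IsHomogeneous d ∧ f = X 2 * g := by
  obtain ⟨q, hq⟩ := X2_dvd_of_dl hf h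
  refine ⟨homogeneousComponent d q, homogeneousComponent_isHomogeneous d q, ?_⟩
  have h1 := comp_mul (isHomogeneous_X ℝ (2 : Fin 3)) q d
  rw [mul_comm q, ← hq, homogeneousComponent_eq_self hf] at h1
  rw [h1, mul_comm]

lemma hom_zero_const {f : S} (hf : f.IsHomogeneous 0) : ∃ r : ℝ, f = C r := by
  refine ⟨coeff 0 f, ?_⟩
  rw [← homogeneousComponent_zero, homogeneousComponent_eq_self hf]

lemma hom_zero {f : S} (hf : f.IsHomogeneous 0) (h : dl f = 0) : f = 0 := by
  obtain ⟨r, rfl⟩ := hom_zero_const hf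
  simpa using h

lemma dl_natDegree {f : S} {d : ℕ} (hf : f.IsHomogeneous d) : (dl f).natDegree ≤ d := by
  rw [dl, aeval_def, eval₂_eq']
  apply Polynomial.natDegree_sum_le_of_forall_le
  intro s hs
  have h := hf.degree_eq_sum_deg_support hs
  rw [Fin.prod_univ_three]
  have h0 : s 0 ≤ d := by
    have h' : s.degree = d := h.symm
    rw [← h', Finsupp.degree_eq_sum, Fin.sum_univ_three]
    omega
  refine Polynomial.natDegree_mul_le.trans ?_
  have e1 : (algebraMap ℝ (Polynomial ℝ) (coeff s f)).natDegree = 0 := by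
    rw [Polynomial.algebraMap_apply]; simp
  rw [e1, zero_add]
  by_cases h2 : s 2 = 0
  · simp [h2, h0]
  · simp [h2]

/-! ### The linear algebra over `ℝ[t]` -/

lemma one_add_X_natDegree (m : ℕ) : ((1 + Polynomial.X : Polynomial ℝ) ^ m).natDegree = m := by
  rw [Polynomial.natDegree_pow, add_comm]
  have := Polynomial.natDegree_X_add_C (1 : ℝ)
  simp only [map_one] at this
  rw [this, mul_one]

lemma one_add_X_ne_zero (m : ℕ) : ((1 + Polynomial.X : Polynomial ℝ) ^ m) ≠ 0 := by
  apply pow_ne_zero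
  intro h
  have := congrArg (Polynomial.eval 0) h
  simp at this

/-- No low-degree syzygies: the key characteristic-zero fact. -/
lemma low_syz (m j : ℕ) (hm : 2 * j + 2 ≤ m) (e : Polynomial ℝ) (he : e.natDegree ≤ j)
    (h : ∀ l, j < l → l < m → (e * (1 + Polynomial.X) ^ m).coeff l = 0) : e = 0 := by
  set E := e * (1 + Polynomial.X) ^ m with hE
  have hEd : E.natDegree ≤ m + j := by
    refine Polynomial.natDegree_mul_le.trans ?_
    rw [one_add_X_natDegree]; omega
  set D := Polynomial.derivative^[j + 1] E with hD
  have d1 : (1 + Polynomial.X : Polynomial ℝ) ^ (m - (j + 1)) ∣ D :=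
    Polynomial.pow_sub_dvd_iterate_derivative_of_pow_dvd (j + 1) (Dvd.intro_left _ rfl)
  have d2 : (Polynomial.X : Polynomial ℝ) ^ (m - (j + 1)) ∣ D := by
    rw [Polynomial.X_pow_dvd_iff]
    intro l hl
    rw [hD, Polynomial.coeff_iterate_derivative, h (l + (j + 1)) (by omega) (by omega), smul_zero]
  have cop : IsCoprime ((1 + Polynomial.X : Polynomial ℝ) ^ (m - (j + 1)))
      ((Polynomial.X : Polynomial ℝ) ^ (m - (j + 1))) := by
    apply IsCoprime.pow
    exact ⟨1, -1, by ring⟩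
  have d3 := cop.mul_dvd d1 d2
  have hD0 : D = 0 := by
    by_contra hne
    have := Polynomial.natDegree_le_of_dvd d3 hne
    rw [Polynomial.natDegree_mul (one_add_X_ne_zero _) (pow_ne_zero _ Polynomial.X_ne_zero),
      one_add_X_natDegree, Polynomial.natDegree_X_pow] at this
    have h2 := Polynomial.natDegree_iterate_derivative E (j + 1)
    rw [← hD] at h2
    omega
  have hEj : E.natDegree ≤ j := by
    rw [Polynomial.natDegree_le_iff_coeff_eq_zero]
    intro l hl
    have h3 := congrArg (fun q => Polynomial.coeff q (l - (j + 1))) hD0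
    simp only [hD, Polynomial.coeff_iterate_derivative, Polynomial.coeff_zero] at h3
    rw [Nat.sub_add_cancel (by omega)] at h3
    rw [nsmul_eq_mul, mul_eq_zero] at h3
    refine h3.resolve_left ?_
    intro h4
    rw [Nat.cast_eq_zero] at h4
    rw [Nat.descFactorial_eq_zero_iff_lt] at h4
    omega
  by_contra hne
  rw [hE, Polynomial.natDegree_mul hne (one_add_X_ne_zero _), one_add_X_natDegree] at hEj
  omega

/-- The coefficient map `γ ↦ (coefficients n,…,n+j of γ(1+t)^m)`. -/
def Kmap (n m j : ℕ) : Polynomial.degreeLT ℝ n →ₗ[ℝ] (Fin (j + 1) → ℝ) where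
  toFun γ := fun r => ((γ : Polynomial ℝ) * (1 + Polynomial.X) ^ m).coeff (n + r)
  map_add' a b := by
    funext r
    simp [add_mul]
  map_smul' c a := by
    funext r
    simp

lemma Kmap_surj (n m j k : ℕ) (hn : n = k + j) (hm : m = k + 2 * j + 1) (hk : 1 ≤ k) :
    Function.Surjective (Kmap n m j) := by
  rw [← LinearMap.range_eq_top]
  by_contra hne
  obtain ⟨φ, hφ, hle⟩ := Submodule.exists_le_ker_of_lt_top _ (lt_top_iff_ne_top.2 hne)
  apply hφ
  set lam : Fin (j + 1) → ℝ := fun r => φ (Pi.single r 1) with hlam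
  have hφs : ∀ v, φ v = ∑ r, v r * lam r := by
    intro v
    rw [LinearMap.pi_apply_eq_sum_univ φ v]
    apply Finset.sum_congr rfl
    intro r _
    simp only [smul_eq_mul, hlam]
    congr 2
    funext i
    simp [Pi.single_apply, eq_comm]
  set e : Polynomial ℝ := ∑ r : Fin (j + 1), Polynomial.C (lam r) * Polynomial.X ^ (j - (r : ℕ)) with he
  have hed : e.natDegree ≤ j := by
    apply Polynomial.natDegree_sum_le_of_forall_le
    intro r _
    refine (Polynomial.natDegree_C_mul_X_pow_le _ _).trans (by omega)
  have he0 : e = 0 := by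
    apply low_syz m j (by omega) e hed
    intro l h1 h2
    have hi : (Polynomial.X ^ (m - 1 - l) : Polynomial ℝ) ∈ Polynomial.degreeLT ℝ n := by
      rw [Polynomial.mem_degreeLT, Polynomial.degree_X_pow]
      exact_mod_cast (by omega : m - 1 - l < n)
    have h3 : φ (Kmap n m j ⟨_, hi⟩) = 0 := hle ⟨_, rfl⟩
    rw [hφs] at h3
    rw [← h3, he, Finset.sum_mul, Polynomial.finsetSum_coeff]
    apply Finset.sum_congr rfl
    intro r _
    have hr := r.2
    simp only [Kmap, LinearMap.coe_mk, AddHom.coe_mk]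
    rw [mul_assoc, Polynomial.coeff_C_mul, mul_comm (Polynomial.X ^ (j - (r : ℕ))),
      Polynomial.coeff_mul_X_pow', if_pos (by omega), mul_comm (Polynomial.X ^ (m - 1 - l)),
      Polynomial.coeff_mul_X_pow', if_pos (by omega), mul_comm]
    congr 2
    omega
  apply LinearMap.ext
  intro v
  rw [hφs, LinearMap.zero_apply]
  apply Finset.sum_eq_zero
  intro r _
  have h4 : e.coeff (j - (r : ℕ)) = lam r := by
    rw [he, Polynomial.finsetSum_coeff, Finset.sum_eq_single r]
    · simp
    · intro b _ hb
      rw [Polynomial.coeff_C_mul_X_pow, if_neg]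
      intro h
      apply hb
      apply Fin.ext
      have := b.2
      have := r.2
      omega
    · simp
  rw [← h4, he0]
  simp

lemma ker_basis {V W : Type*} [AddCommGroup V] [Module ℝ V] [AddCommGroup W] [Module ℝ W]
    [FiniteDimensional ℝ V] (f : V →ₗ[ℝ] W) (p : ℕ)
    (h : Module.finrank ℝ (LinearMap.ker f) = p) :
    ∃ τ : Fin p → V, (∀ l, f (τ l) = 0) ∧
      (∀ g : Fin p → ℝ, ∑ l, g l • τ l = 0 → ∀ l, g l = 0) ∧
      ∀ v, f v = 0 → ∃ c : Fin p → ℝ, v = ∑ l, c l • τ l := by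
  let b := Module.finBasisOfFinrankEq ℝ (LinearMap.ker f) h
  refine ⟨fun l => (b l : V), fun l => (b l).2, ?_, ?_⟩
  · intro g hg
    apply Fintype.linearIndependent_iff.1 b.linearIndependent g
    apply Subtype.ext
    simpa using hg
  · intro v hv
    refine ⟨fun l => b.repr ⟨v, hv⟩ l, ?_⟩
    have h := congrArg (fun q : LinearMap.ker f => (q : V)) (b.sum_repr ⟨v, hv⟩)
    simp only [Submodule.coe_sum, Submodule.coe_smul] at h
    exact h.symm

lemma K_exists (n m j k : ℕ) (hn : n = k + j) (hm : m = k + 2 * j + 1) (hk : 1 ≤ k) :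
    ∃ τ : Fin (k - 1) → Polynomial ℝ, (∀ l, (τ l).natDegree < n) ∧
      (∀ l r, n ≤ r → r < m → (τ l * (1 + Polynomial.X) ^ m).coeff r = 0) ∧
      (∀ g : Fin (k - 1) → ℝ, ∑ l, g l • τ l = 0 → ∀ l, g l = 0) ∧
      (∀ γ : Polynomial ℝ, γ.natDegree < n →
        (∀ r, n ≤ r → r < m → (γ * (1 + Polynomial.X) ^ m).coeff r = 0) →
        ∃ c : Fin (k - 1) → ℝ, γ = ∑ l, c l • τ l) ∧
      (∀ w : ℕ → ℝ, ∃ γ : Polynomial ℝ, γ.natDegree < n ∧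
        ∀ r, n ≤ r → r < m → (γ * (1 + Polynomial.X) ^ m).coeff r = w r) := by
  have hs := Kmap_surj n m j k hn hm hk
  have hfr : Module.finrank ℝ (Polynomial.degreeLT ℝ n) = n := by
    rw [(Polynomial.degreeLTEquiv ℝ n).finrank_eq]; simp
  have : Module.Finite ℝ (Polynomial.degreeLT ℝ n) :=
    Module.Finite.equiv (Polynomial.degreeLTEquiv ℝ n).symm
  have hker : Module.finrank ℝ (LinearMap.ker (Kmap n m j)) = k - 1 := by
    have h := LinearMap.finrank_range_add_finrank_ker (Kmap n m j)
    rw [LinearMap.range_eq_top.2 hs, finrank_top, hfr, Module.finrank_fin_fun] at h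
    omega
  have hdeg : ∀ γ : Polynomial ℝ, γ ∈ Polynomial.degreeLT ℝ n ↔ γ.natDegree < n := by
    intro γ
    rw [Polynomial.mem_degreeLT]
    by_cases h0 : γ = 0
    · subst h0; simp; omega
    · rw [Polynomial.degree_eq_natDegree h0]; exact_mod_cast Iff.rfl
  have hcoef : ∀ (γ : Polynomial.degreeLT ℝ n) (w : ℕ → ℝ),
      Kmap n m j γ = (fun r : Fin (j + 1) => w (n + (r : ℕ))) ↔
      ∀ r, n ≤ r → r < m → ((γ : Polynomial ℝ) * (1 + Polynomial.X) ^ m).coeff r = w r := by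
    intro γ w
    constructor
    · intro h r h1 h2
      have := congrFun h (⟨r - n, by omega⟩ : Fin (j + 1))
      simp only [Kmap, LinearMap.coe_mk, AddHom.coe_mk] at this
      rwa [Nat.add_sub_cancel' h1] at this
    · intro h
      funext r
      exact h (n + r) (by omega) (by have := r.2; omega)
  obtain ⟨b, b1, b2, b3⟩ := ker_basis (Kmap n m j) (k - 1) hker
  refine ⟨fun l => (b l : Polynomial ℝ), ?_, ?_, ?_, ?_, ?_⟩
  · intro l
    exact (hdeg _).1 (b l).2
  · intro l
    exact (hcoef (b l) (fun _ => 0)).1 (by rw [b1 l]; rfl)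
  · intro g hg
    apply b2 g
    apply Subtype.ext
    simpa using hg
  · intro γ h1 h2
    obtain ⟨c, hc⟩ := b3 ⟨γ, (hdeg γ).2 h1⟩ ((hcoef ⟨γ, (hdeg γ).2 h1⟩ (fun _ => 0)).2 h2)
    refine ⟨c, ?_⟩
    have h' := congrArg (fun q : Polynomial.degreeLT ℝ n => (q : Polynomial ℝ)) hc
    simpa using h'
  · intro w
    obtain ⟨γ, hγ⟩ := hs (fun r => w (n + r))
    exact ⟨γ, (hdeg _).1 γ.2, (hcoef γ w).1 hγ⟩
/-! ### The syzygy module -/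

/-- `∏ (x - s z)`. -/
def pA (n m : ℕ) : S := ff (-X 2) (X 0 - (n : S) * X 2) m
/-- `∏ (y - s z)`. -/
def pB (n m : ℕ) : S := ff (-X 2) (X 1 - (n : S) * X 2) m
/-- `∏ (x + y - s z)`. -/
def pC (n m : ℕ) : S := ff (-X 2) (X 0 + X 1 - (n : S) * X 2) m

/-- Syzygies of the three products. -/
def Msyz (n m : ℕ) : Submodule S (Fin 3 → S) where
  carrier := {t | t 0 * pA n m + t 1 * pB n m = t 2 * pC n m}
  add_mem' := by
    intro a b ha hb
    change (a 0 + b 0) * pA n m + (a 1 + b 1) * pB n m = (a 2 + b 2) * pC n m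
    change a 0 * pA n m + a 1 * pB n m = a 2 * pC n m at ha
    change b 0 * pA n m + b 1 * pB n m = b 2 * pC n m at hb
    linear_combination ha + hb
  zero_mem' := by
    change (0 : S) * pA n m + 0 * pB n m = 0 * pC n m
    ring
  smul_mem' := by
    intro c a ha
    change (c * a 0) * pA n m + (c * a 1) * pB n m = (c * a 2) * pC n m
    change a 0 * pA n m + a 1 * pB n m = a 2 * pC n m at ha
    linear_combination c * ha

lemma mem_Msyz {n m : ℕ} {t : Fin 3 → S} :
    t ∈ Msyz n m ↔ t 0 * pA n m + t 1 * pB n m = t 2 * pC n m := Iff.rfl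

lemma hom_nz (n : ℕ) : ((n : S) * X 2).IsHomogeneous 1 := by
  have := (isHomogeneous_X ℝ (2 : Fin 3)).C_mul (n : ℝ)
  simpa using this

lemma pA_hom (n m : ℕ) : (pA n m).IsHomogeneous m :=
  ff_hom (isHomogeneous_X ℝ _).neg ((isHomogeneous_X ℝ _).sub (hom_nz n)) m
lemma pB_hom (n m : ℕ) : (pB n m).IsHomogeneous m :=
  ff_hom (isHomogeneous_X ℝ _).neg ((isHomogeneous_X ℝ _).sub (hom_nz n)) m
lemma pC_hom (n m : ℕ) : (pC n m).IsHomogeneous m :=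
  ff_hom (isHomogeneous_X ℝ _).neg
    (((isHomogeneous_X ℝ _).add (isHomogeneous_X ℝ _)).sub (hom_nz n)) m

lemma dl_pA (n m : ℕ) : dl (pA n m) = Polynomial.X ^ m := by
  rw [pA, dl_ff (by simp)]; simp
lemma dl_pB (n m : ℕ) : dl (pB n m) = 1 := by
  rw [pB, dl_ff (by simp)]; simp
lemma dl_pC (n m : ℕ) : dl (pC n m) = (1 + Polynomial.X) ^ m := by
  rw [pC, dl_ff (by simp)]; simp [add_comm]

lemma dl_syz {n m : ℕ} {t : Fin 3 → S} (h : t ∈ Msyz n m) :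
    dl (t 0) * Polynomial.X ^ m + dl (t 1) = dl (t 2) * (1 + Polynomial.X) ^ m := by
  have := congrArg dl (mem_Msyz.1 h)
  simpa [dl_pA, dl_pB, dl_pC] using this

/-- Every syzygy of `(t^m, 1, (1+t)^m)` of degree exactly `n` lifts. -/
lemma lift_syz (n m : ℕ) (α β γ : Polynomial ℝ) (hα : α.natDegree ≤ n) (hβ : β.natDegree ≤ n)
    (hγ : γ.natDegree ≤ n) (h : α * Polynomial.X ^ m + β = γ * (1 + Polynomial.X) ^ m) :
    ∃ t ∈ Msyz n m, (∀ i, (t i).IsHomogeneous n) ∧ dl (t 0) = α ∧ dl (t 1) = β ∧ dl (t 2) = γ := by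
  set ε : S := -X 2 with hε
  set u : S := X 0 - (n : S) * X 2 with hu
  set v : S := X 1 - (n : S) * X 2 with hv
  have hεh : ε.IsHomogeneous 1 := (isHomogeneous_X ℝ _).neg
  have huh : u.IsHomogeneous 1 := (isHomogeneous_X ℝ _).sub (hom_nz n)
  have hvh : v.IsHomogeneous 1 := (isHomogeneous_X ℝ _).sub (hom_nz n)
  have hmε : ((m : S) * ε).IsHomogeneous 1 := by
    rw [hε, mul_neg]; exact (hom_nz m).neg
  refine ⟨![lum ε (u - (m : S) * ε) v n α, lum ε u (v - (m : S) * ε) n β, lum ε u v n γ],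
    ?_, ?_, ?_, ?_, ?_⟩
  · rw [mem_Msyz]
    have h1 := congrArg (lum ε u v (n + m)) h
    rw [lum_add, lum_pow _ _ _ _ _ _ hγ, lum_low _ _ _ _ _ _ hβ, lum_high] at h1
    have e : u + v - (n : S) * ε = X 0 + X 1 - (n : S) * X 2 := by
      rw [hu, hv, hε]; ring
    rw [e] at h1
    exact h1
  · intro i
    fin_cases i
    · exact lum_hom hεh (huh.sub hmε) hvh _ _
    · exact lum_hom hεh huh (hvh.sub hmε) _ _
    · exact lum_hom hεh huh hvh _ _
  · exact dl_lum (by simp [hε]) (by simp [hε, hu]) (by simp [hv]) _ _ hα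
  · exact dl_lum (by simp [hε]) (by simp [hu]) (by simp [hε, hv]) _ _ hβ
  · exact dl_lum (by simp [hε]) (by simp [hu]) (by simp [hv]) _ _ hγ

lemma split_poly (n m : ℕ) (hnm : n < m) (P : Polynomial ℝ) (hP : P.natDegree ≤ n + m)
    (h : ∀ r, n < r → r < m → P.coeff r = 0) :
    ∃ α β : Polynomial ℝ, α.natDegree ≤ n ∧ β.natDegree ≤ n ∧ α * Polynomial.X ^ m + β = P ∧
      α.coeff 0 = P.coeff m ∧ β.coeff 0 = P.coeff 0 := by
  let α : Polynomial ℝ := ∑ i ∈ Finset.range (n + 1), Polynomial.C (P.coeff (m + i)) * Polynomial.X ^ i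
  let β : Polynomial ℝ := ∑ i ∈ Finset.range (n + 1), Polynomial.C (P.coeff i) * Polynomial.X ^ i
  have hα : ∀ l, α.coeff l = if l < n + 1 then P.coeff (m + l) else 0 := by
    intro l
    simp [α, Polynomial.finsetSum_coeff, Polynomial.coeff_C_mul, Polynomial.coeff_X_pow]
  have hβ : ∀ l, β.coeff l = if l < n + 1 then P.coeff l else 0 := by
    intro l
    simp [β, Polynomial.finsetSum_coeff, Polynomial.coeff_C_mul, Polynomial.coeff_X_pow]
  refine ⟨α, β, ?_, ?_, ?_, ?_, ?_⟩
  · rw [Polynomial.natDegree_le_iff_coeff_eq_zero]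
    intro l hl
    rw [hα, if_neg (by omega)]
  · rw [Polynomial.natDegree_le_iff_coeff_eq_zero]
    intro l hl
    rw [hβ, if_neg (by omega)]
  · ext l
    rw [Polynomial.coeff_add, Polynomial.coeff_mul_X_pow', hβ]
    by_cases h1 : m ≤ l
    · rw [if_pos h1, hα, if_neg (by omega : ¬ l < n + 1), add_zero]
      split_ifs with h2
      · rw [Nat.add_sub_cancel' h1]
      · rw [Polynomial.coeff_eq_zero_of_natDegree_lt (by omega)]
    · rw [if_neg h1, zero_add]
      split_ifs with h2
      · rfl
      · rw [h l (by omega) (by omega)]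
  · rw [hα]; simp
  · rw [hβ]; simp

/-- Lift of an admissible `γ`. -/
lemma lift_gamma (n m : ℕ) (hnm : n < m) (γ : Polynomial ℝ) (hγ : γ.natDegree ≤ n)
    (h : ∀ r, n < r → r < m → (γ * (1 + Polynomial.X) ^ m).coeff r = 0) :
    ∃ t ∈ Msyz n m, (∀ i, (t i).IsHomogeneous n) ∧ dl (t 2) = γ ∧
      (dl (t 0)).coeff 0 = (γ * (1 + Polynomial.X) ^ m).coeff m ∧
      (dl (t 1)).coeff 0 = γ.coeff 0 := by
  have hd : (γ * (1 + Polynomial.X) ^ m).natDegree ≤ n + m := by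
    refine Polynomial.natDegree_mul_le.trans ?_
    rw [one_add_X_natDegree]; omega
  obtain ⟨α, β, h1, h2, h3, h4, h5⟩ := split_poly n m hnm _ hd h
  obtain ⟨t, ht, hh, e0, e1, e2⟩ := lift_syz n m α β γ h1 h2 hγ h3
  refine ⟨t, ht, hh, e2, ?_, ?_⟩
  · rw [e0, h4]
  · rw [e1, h5, Polynomial.mul_coeff_zero, Polynomial.coeff_zero_eq_eval_zero ((1 + Polynomial.X) ^ m)]
    simp

/-! ### There are no syzygies of small degree -/

lemma two_syz (n m d : ℕ) (hd : d < m) (a b : S) (ha : a.IsHomogeneous d) (hb : b.IsHomogeneous d)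
    (h : a * pA n m + b * pB n m = 0) : a = 0 ∧ b = 0 := by
  induction d generalizing a b with
  | zero =>
    have h1 := congrArg dl h
    simp only [map_add, map_mul, dl_pA, dl_pB, mul_one, map_zero] at h1
    obtain ⟨p, rfl⟩ := hom_zero_const ha
    obtain ⟨q, rfl⟩ := hom_zero_const hb
    have e1 := congrArg (fun f => Polynomial.coeff f m) h1
    have e0 := congrArg (fun f => Polynomial.coeff f 0) h1
    have hm : m ≠ 0 := by omega
    simp [Polynomial.coeff_C, hm] at e1
    simp [Polynomial.coeff_X_pow, Ne.symm hm, hm] at e0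
    simp [e0, e1]
  | succ d ih =>
    have h1 := congrArg dl h
    simp only [map_add, map_mul, dl_pA, dl_pB, mul_one, map_zero] at h1
    have hb0 : dl b = 0 := by
      ext l
      rw [Polynomial.coeff_zero]
      by_cases hl : l < m
      · have := congrArg (fun f => Polynomial.coeff f l) h1
        simpa [Polynomial.coeff_mul_X_pow', Nat.not_le.2 hl] using this
      · rw [Polynomial.coeff_eq_zero_of_natDegree_lt]
        have := dl_natDegree hb
        omega
    have ha0 : dl a = 0 := by
      rw [hb0, add_zero] at h1
      exact (mul_eq_zero.1 h1).resolve_right (pow_ne_zero _ Polynomial.X_ne_zero)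
    obtain ⟨a', ha', rfl⟩ := hom_div ha ha0
    obtain ⟨b', hb', rfl⟩ := hom_div hb hb0
    have h2 : X 2 * (a' * pA n m + b' * pB n m) = 0 := by linear_combination h
    obtain ⟨rfl, rfl⟩ := ih (by omega) a' b' ha' hb'
      ((mul_eq_zero.1 h2).resolve_left (X_ne_zero _))
    simp

lemma simplex_zero (n : ℕ) (q : MvPolynomial (Fin 2) ℝ) (hq : q.totalDegree < n)
    (h : ∀ μ ν : ℕ, μ + ν < n → eval (![(μ : ℝ), (ν : ℝ)]) q = 0) : q = 0 := by
  by_contra hne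
  obtain ⟨t, ht, hdeg⟩ := Finset.exists_mem_eq_sup q.support (support_nonempty.2 hne)
    (fun s => s.sum fun _ e => e)
  have hdeg' : q.totalDegree = t.degree := hdeg
  obtain ⟨s, hs, hev⟩ := combinatorial_nullstellensatz_exists_eval_nonzero q t
    (mem_support_iff.1 ht) hdeg'
    (fun i => (Finset.range (t i + 1)).image (fun a : ℕ => (a : ℝ))) (by
      intro i
      rw [Finset.card_image_of_injective _ Nat.cast_injective]
      simp)
  obtain ⟨μ, hμ, e0⟩ := Finset.mem_image.1 (hs 0)
  obtain ⟨ν, hν, e1⟩ := Finset.mem_image.1 (hs 1)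
  rw [Finset.mem_range] at hμ hν
  have hsum : t 0 + t 1 = t.degree := by
    rw [Finsupp.degree_eq_sum, Fin.sum_univ_two]
  apply hev
  have : s = ![(μ : ℝ), (ν : ℝ)] := by
    funext i
    fin_cases i
    · exact e0.symm
    · exact e1.symm
  rw [this]
  exact h μ ν (by omega)

lemma dehom_zero (n d : ℕ) (hd : d < n) (c : S) (hc : c.IsHomogeneous d)
    (h : ∀ μ ν : ℕ, μ + ν < n → eval (![(n : ℝ) - μ, (n : ℝ) - ν, 1]) c = 0) : c = 0 := by
  set g : Fin 3 → MvPolynomial (Fin 2) ℝ := ![C (n : ℝ) - X 0, C (n : ℝ) - X 1, 1] with hg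
  set q : MvPolynomial (Fin 2) ℝ := aeval g c with hq
  have hev : ∀ p : Fin 2 → ℝ, eval p q = eval (![(n : ℝ) - p 0, (n : ℝ) - p 1, 1]) c := by
    intro p
    have : (eval p).comp (aeval g : S →ₐ[ℝ] MvPolynomial (Fin 2) ℝ).toRingHom =
        eval (![(n : ℝ) - p 0, (n : ℝ) - p 1, 1]) := by
      apply MvPolynomial.ringHom_ext
      · intro r; simp
      · intro i; fin_cases i <;> simp [hg]
    exact RingHom.congr_fun this c
  have hgd : ∀ i, (g i).totalDegree ≤ 1 := by
    intro i
    fin_cases i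
    · exact (totalDegree_sub _ _).trans (by rw [totalDegree_C, totalDegree_X]; simp)
    · exact (totalDegree_sub _ _).trans (by rw [totalDegree_C, totalDegree_X]; simp)
    · simp [hg]
  have hqd : q.totalDegree ≤ d := by
    rw [hq, aeval_def, eval₂_eq']
    apply totalDegree_finsetSum_le
    intro s hs
    have hsd : s.degree = d := (hc.degree_eq_sum_deg_support hs).symm
    refine (totalDegree_mul _ _).trans ?_
    rw [algebraMap_eq, totalDegree_C, zero_add]
    refine (totalDegree_finsetProd _ _).trans ?_
    rw [← hsd, Finsupp.degree_eq_sum]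
    apply Finset.sum_le_sum
    intro i _
    refine (totalDegree_pow _ _).trans ?_
    have := hgd i
    nlinarith
  have hq0 : q = 0 := by
    apply simplex_zero n q (by omega)
    intro μ ν hμν
    rw [hev]
    exact h μ ν hμν
  have h1 : X 2 * c = 0 := by
    apply MvPolynomial.funext
    intro p
    rw [map_mul, map_zero, eval_X]
    by_cases hp : p 2 = 0
    · simp [hp]
    · have e1 : p = fun i => p 2 * (![p 0 / p 2, p 1 / p 2, 1] : Fin 3 → ℝ) i := by
        funext i
        fin_cases i <;> simp <;> field_simp
      have e2 := hev ![n - p 0 / p 2, n - p 1 / p 2]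
      rw [hq0] at e2
      simp at e2
      rw [e1, eval_smul_hom hc, ← e2]
      simp
  exact (mul_eq_zero.1 h1).resolve_left (X_ne_zero _)

lemma eval_ff (p : Fin 3 → ℝ) (ε u : S) (i : ℕ) :
    eval p (ff ε u i) = ∏ s ∈ Finset.range i, (eval p u - s * eval p ε) := by
  simp [ff, map_prod]

lemma low_zero (n m d : ℕ) (hd : d < n) (hnm : n < m) (t : Fin 3 → S) (ht : t ∈ Msyz n m)
    (hh : ∀ i, (t i).IsHomogeneous d) : t = 0 := by
  have hc : t 2 = 0 := by
    apply dehom_zero n d hd _ (hh 2)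
    intro μ ν hμν
    have h1 := congrArg (eval (![(n : ℝ) - μ, (n : ℝ) - ν, 1])) (mem_Msyz.1 ht)
    have hA : eval (![(n : ℝ) - μ, (n : ℝ) - ν, 1]) (pA n m) = 0 := by
      rw [pA, eval_ff]
      apply Finset.prod_eq_zero (i := μ) (Finset.mem_range.2 (by omega))
      simp
    have hB : eval (![(n : ℝ) - μ, (n : ℝ) - ν, 1]) (pB n m) = 0 := by
      rw [pB, eval_ff]
      apply Finset.prod_eq_zero (i := ν) (Finset.mem_range.2 (by omega))
      simp
    have hC : eval (![(n : ℝ) - μ, (n : ℝ) - ν, 1]) (pC n m) ≠ 0 := by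
      rw [pC, eval_ff, Finset.prod_ne_zero_iff]
      intro s _
      have : (μ : ℝ) + ν < n := by exact_mod_cast hμν
      have h0 : (0 : ℝ) ≤ s := Nat.cast_nonneg s
      simp
      intro h
      linarith
    rw [map_add, map_mul, map_mul, map_mul, hA, hB] at h1
    simp only [mul_zero, add_zero] at h1
    exact (mul_eq_zero.1 h1.symm).resolve_right hC
  have h2 := mem_Msyz.1 ht
  rw [hc, zero_mul] at h2
  obtain ⟨h0, h1⟩ := two_syz n m d (by omega) _ _ (hh 0) (hh 1) h2
  funext i
  fin_cases i
  · exact h0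
  · exact h1
  · exact hc
/-! ### Generators of the syzygy module -/

/-- Triples of polynomials of degree at most `d` satisfying the dehomogenised syzygy equation. -/
def IsF (m d : ℕ) (P : Fin 3 → Polynomial ℝ) : Prop :=
  (∀ i, (P i).natDegree ≤ d) ∧
    P 0 * Polynomial.X ^ m + P 1 = P 2 * (1 + Polynomial.X) ^ m

lemma IsF.mono {m d e : ℕ} {P : Fin 3 → Polynomial ℝ} (h : IsF m d P) (hde : d ≤ e) : IsF m e P :=
  ⟨fun i => (h.1 i).trans hde, h.2⟩

lemma IsF_dl {n m d : ℕ} {t : Fin 3 → S} (ht : t ∈ Msyz n m) (hh : ∀ i, (t i).IsHomogeneous d) :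
    IsF m d (fun i => dl (t i)) :=
  ⟨fun i => dl_natDegree (hh i), dl_syz ht⟩

lemma IsF.coeff_zero {m d : ℕ} {P : Fin 3 → Polynomial ℝ} (h : IsF m d P) (hm : 0 < m) :
    (P 2).coeff 0 = (P 1).coeff 0 := by
  have h1 := congrArg (Polynomial.eval 0) h.2
  simp only [Polynomial.eval_add, Polynomial.eval_mul, Polynomial.eval_pow, Polynomial.eval_X,
    Polynomial.eval_one, zero_pow hm.ne', mul_zero, zero_add, add_zero, one_pow, mul_one] at h1
  rw [Polynomial.coeff_zero_eq_eval_zero, Polynomial.coeff_zero_eq_eval_zero, h1]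

lemma eq_X_mul {p : Polynomial ℝ} {d : ℕ} (hp : p.natDegree ≤ d + 1) (h : p.coeff 0 = 0) :
    ∃ q : Polynomial ℝ, q.natDegree ≤ d ∧ p = Polynomial.X * q := by
  refine ⟨p.divX, ?_, ?_⟩
  · rw [Polynomial.natDegree_divX_eq_natDegree_tsub_one]; omega
  · have := Polynomial.X_mul_divX_add p
    rw [h, map_zero, add_zero] at this
    exact this.symm

lemma IsF.div {m d : ℕ} {P : Fin 3 → Polynomial ℝ} (h : IsF m (d + 1) P) (hm : 0 < m)
    (h0 : (P 0).coeff 0 = 0) (h1 : (P 1).coeff 0 = 0) :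
    ∃ Q, IsF m d Q ∧ ∀ i, P i = Polynomial.X * Q i := by
  have hz : ∀ i, (P i).coeff 0 = 0 := by
    intro i
    fin_cases i
    · exact h0
    · exact h1
    · exact (h.coeff_zero hm).trans h1
  choose Q hQ hPQ using fun i => eq_X_mul (h.1 i) (hz i)
  refine ⟨Q, ⟨hQ, ?_⟩, hPQ⟩
  apply mul_left_cancel₀ (Polynomial.X_ne_zero (R := ℝ))
  have := h.2
  rw [hPQ 0, hPQ 1, hPQ 2] at this
  linear_combination this

lemma IsF.vanish {n m d : ℕ} {P : Fin 3 → Polynomial ℝ} (h : IsF m d P) (hd : d < n) :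
    ∀ r, n ≤ r → r < m → (P 2 * (1 + Polynomial.X) ^ m).coeff r = 0 := by
  intro r hr hrm
  rw [← h.2, Polynomial.coeff_add, Polynomial.coeff_mul_X_pow', if_neg (by omega), zero_add]
  exact Polynomial.coeff_eq_zero_of_natDegree_lt (by have := h.1 1; omega)

lemma IsF.ext_two {m d : ℕ} {P Q : Fin 3 → Polynomial ℝ} (hP : IsF m d P) (hQ : IsF m d Q)
    (hd : d < m) (h : P 2 = Q 2) : P = Q := by
  have e : (P 0 - Q 0) * Polynomial.X ^ m + (P 1 - Q 1) = 0 := by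
    have h1 := hP.2
    have h2 := hQ.2
    rw [h] at h1
    linear_combination h1 - h2
  have e1 : P 1 - Q 1 = 0 := by
    ext l
    rw [Polynomial.coeff_zero]
    by_cases hl : l < m
    · have := congrArg (fun f => Polynomial.coeff f l) e
      simp only [Polynomial.coeff_add, Polynomial.coeff_mul_X_pow', if_neg (Nat.not_le.2 hl),
        zero_add, Polynomial.coeff_zero] at this
      exact this
    · apply Polynomial.coeff_eq_zero_of_natDegree_lt
      refine (Polynomial.natDegree_sub_le _ _).trans_lt ?_
      have := hP.1 1
      have := hQ.1 1
      rw [max_lt_iff]; omega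
  have e0 : P 0 - Q 0 = 0 := by
    rw [e1, add_zero] at e
    exact (mul_eq_zero.1 e).resolve_right (pow_ne_zero _ Polynomial.X_ne_zero)
  funext i
  fin_cases i
  · exact sub_eq_zero.1 e0
  · exact sub_eq_zero.1 e1
  · exact h

/-- A well chosen system of `q + 2` syzygies of degree `n`. -/
structure GD (n m q : ℕ) where
  th : Fin 2 ⊕ Fin q → Fin 3 → S
  tp : Fin q → Polynomial ℝ
  npos : 0 < n
  nm : n < m
  mem : ∀ i, th i ∈ Msyz n m
  hom : ∀ i c, (th i c).IsHomogeneous n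
  s00 : (dl (th (Sum.inl 0) 0)).coeff 0 = 1
  s01 : (dl (th (Sum.inl 0) 1)).coeff 0 = 0
  s10 : (dl (th (Sum.inl 1) 0)).coeff 0 = 0
  s11 : (dl (th (Sum.inl 1) 1)).coeff 0 = 1
  t0 : ∀ l, (dl (th (Sum.inr l) 0)).coeff 0 = 0
  t1 : ∀ l, (dl (th (Sum.inr l) 1)).coeff 0 = 0
  t2 : ∀ l, dl (th (Sum.inr l) 2) = Polynomial.X * tp l
  indep : ∀ g : Fin q → ℝ, ∑ l, g l • tp l = 0 → ∀ l, g l = 0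
  span : ∀ γ : Polynomial ℝ, γ.natDegree < n →
    (∀ r, n ≤ r → r < m → (γ * (1 + Polynomial.X) ^ m).coeff r = 0) →
    ∃ c : Fin q → ℝ, γ = ∑ l, c l • tp l

lemma coeff_X_mul_one_add (p : Polynomial ℝ) (m r : ℕ) :
    (Polynomial.X * p * (1 + Polynomial.X) ^ m).coeff (r + 1) =
      (p * (1 + Polynomial.X) ^ m).coeff r := by
  rw [mul_assoc, Polynomial.coeff_X_mul]

lemma coeff_one_add (m r : ℕ) :
    ((1 + Polynomial.X : Polynomial ℝ) ^ m).coeff r = (m.choose r : ℝ) := by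
  exact Polynomial.coeff_one_add_X_pow ℝ m r

lemma GD_exists (n m j k : ℕ) (hn : n = k + j) (hm : m = k + 2 * j + 1) (hk : 1 ≤ k) :
    Nonempty (GD n m (k - 1)) := by
  obtain ⟨τ, hdeg, hvan, hind, hspan, hsurj⟩ := K_exists n m j k hn hm hk
  have hnm : n < m := by omega
  have hdX : ∀ p : Polynomial ℝ, p.natDegree < n → (Polynomial.X * p).natDegree ≤ n := by
    intro p hp
    refine Polynomial.natDegree_mul_le.trans ?_
    rw [Polynomial.natDegree_X]; omega
  -- the elements `τ`
  have hτ : ∀ l, ∃ t ∈ Msyz n m, (∀ i, (t i).IsHomogeneous n) ∧ dl (t 2) = Polynomial.X * τ l ∧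
      (dl (t 0)).coeff 0 = 0 ∧ (dl (t 1)).coeff 0 = 0 := by
    intro l
    obtain ⟨t, ht, hh, e2, e0, e1⟩ := lift_gamma n m hnm (Polynomial.X * τ l) (hdX _ (hdeg l)) (by
      intro r hr hrm
      obtain ⟨r, rfl⟩ : ∃ r', r = r' + 1 := ⟨r - 1, by omega⟩
      rw [coeff_X_mul_one_add]
      exact hvan l r (by omega) (by omega))
    refine ⟨t, ht, hh, e2, ?_, ?_⟩
    · rw [e0]
      obtain ⟨r, rfl⟩ : ∃ r', m = r' + 1 := ⟨m - 1, by omega⟩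
      rw [coeff_X_mul_one_add]
      exact hvan l r (by omega) (by omega)
    · rw [e1]; simp
  choose tau hm1 hh1 e21 e01 e11 using hτ
  obtain ⟨γ1, hγ1, hw1⟩ := hsurj (fun r => if r + 1 = m then 1 else 0)
  obtain ⟨s1, hs1, hhs1, e2s1, e0s1, e1s1⟩ := lift_gamma n m hnm (Polynomial.X * γ1)
    (hdX _ hγ1) (by
      intro r hr hrm
      obtain ⟨r, rfl⟩ : ∃ r', r = r' + 1 := ⟨r - 1, by omega⟩
      rw [coeff_X_mul_one_add, hw1 r (by omega) (by omega), if_neg (by omega)])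
  obtain ⟨γ2, hγ2, hw2⟩ := hsurj (fun r => -(m.choose (r + 1) : ℝ))
  have hz : ∀ r, n < r → r ≤ m →
      ((1 + Polynomial.X * γ2) * (1 + Polynomial.X) ^ m).coeff r = 0 := by
    intro r hr hrm
    obtain ⟨r, rfl⟩ : ∃ r', r = r' + 1 := ⟨r - 1, by omega⟩
    rw [add_mul, one_mul, Polynomial.coeff_add, coeff_X_mul_one_add, hw2 r (by omega) (by omega),
      coeff_one_add]
    ring
  obtain ⟨s2, hs2, hhs2, e2s2, e0s2, e1s2⟩ := lift_gamma n m hnm (1 + Polynomial.X * γ2)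
    ((Polynomial.natDegree_add_le _ _).trans (by
      rw [Polynomial.natDegree_one]
      exact max_le (Nat.zero_le _) (hdX _ hγ2)))
    (fun r hr hrm => hz r hr hrm.le)
  exact ⟨{
    th := Sum.elim ![s1, s2] tau
    tp := τ
    npos := by omega
    nm := hnm
    mem := by
      rintro (i | l)
      · fin_cases i
        · exact hs1
        · exact hs2
      · exact hm1 l
    hom := by
      rintro (i | l)
      · fin_cases i
        · exact hhs1
        · exact hhs2
      · exact hh1 l
    s00 := by
      change (dl (s1 0)).coeff 0 = 1
      rw [e0s1]
      obtain ⟨r, hr⟩ : ∃ r', m = r' + 1 := ⟨m - 1, by omega⟩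
      have : (Polynomial.X * γ1 * (1 + Polynomial.X) ^ m).coeff (r + 1) = 1 := by
        rw [coeff_X_mul_one_add, hw1 r (by omega) (by omega), if_pos hr.symm]
      rwa [← hr] at this
    s01 := by
      change (dl (s1 1)).coeff 0 = 0
      rw [e1s1]; simp
    s10 := by
      change (dl (s2 0)).coeff 0 = 0
      rw [e0s2]
      exact hz m hnm le_rfl
    s11 := by
      change (dl (s2 1)).coeff 0 = 1
      rw [e1s2]; simp
    t0 := e01
    t1 := e11
    t2 := e21
    indep := hind
    span := hspan }⟩

namespace GD

variable {n m q : ℕ} (D : GD n m q)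

lemma isF (i : Fin 2 ⊕ Fin q) : IsF m n (fun c => dl (D.th i c)) := IsF_dl (D.mem i) (D.hom i)

lemma mpos {n m q : ℕ} (D : GD n m q) : 0 < m := by have := D.nm; omega

lemma sub_step (d : ℕ) (hd : n ≤ d + 1) (P : Fin 3 → Polynomial ℝ) (hP : IsF m (d + 1) P) :
    ∃ Q, IsF m d Q ∧ ∀ c, P c = Polynomial.C ((P 0).coeff 0) * dl (D.th (Sum.inl 0) c) +
      Polynomial.C ((P 1).coeff 0) * dl (D.th (Sum.inl 1) c) + Polynomial.X * Q c := by
  set u := (P 0).coeff 0 with hu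
  set v := (P 1).coeff 0 with hv
  have hR : IsF m (d + 1) (fun c => P c - Polynomial.C u * dl (D.th (Sum.inl 0) c) -
      Polynomial.C v * dl (D.th (Sum.inl 1) c)) := by
    have h0 := (D.isF (Sum.inl 0)).mono hd
    have h1 := (D.isF (Sum.inl 1)).mono hd
    refine ⟨?_, ?_⟩
    · intro c
      refine (Polynomial.natDegree_sub_le _ _).trans (max_le
        ((Polynomial.natDegree_sub_le _ _).trans (max_le (hP.1 c) ?_)) ?_)
      · exact (Polynomial.natDegree_C_mul_le _ _).trans (h0.1 c)
      · exact (Polynomial.natDegree_C_mul_le _ _).trans (h1.1 c)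
    · have e := hP.2
      have e0 := h0.2
      have e1 := h1.2
      simp only at e0 e1 ⊢
      linear_combination e - Polynomial.C u * e0 - Polynomial.C v * e1
  obtain ⟨Q, hQ, hPQ⟩ := hR.div D.mpos
    (by simp [D.s00, D.s10, hu]) (by simp [D.s01, D.s11, hv])
  refine ⟨Q, hQ, fun c => ?_⟩
  rw [← hPQ c]; ring

/-- Surjectivity modulo `z`. -/
lemma claim1 (e : ℕ) (P : Fin 3 → Polynomial ℝ) (hP : IsF m (n + e) P) :
    ∃ a : Fin 2 ⊕ Fin q → S, (∀ i, (a i).IsHomogeneous e) ∧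
      ∀ c, ∑ i, dl (a i) * dl (D.th i c) = P c := by
  induction e generalizing P with
  | zero =>
    have hn := D.npos
    obtain ⟨d, hd⟩ : ∃ d, n = d + 1 := ⟨n - 1, by omega⟩
    rw [add_zero] at hP
    have hP' : IsF m (d + 1) P := hP.mono hd.le
    obtain ⟨Q, hQ, hPQ⟩ := D.sub_step d hd.le P hP'
    obtain ⟨g, hg⟩ := D.span (Q 2) (by have := hQ.1 2; omega) (hQ.vanish (by omega))
    have hext : (fun c => ∑ l, Polynomial.C (g l) * dl (D.th (Sum.inr l) c)) =
        (fun c => Polynomial.X * Q c) := by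
      refine IsF.ext_two (m := m) (d := n) ⟨?_, ?_⟩ ⟨?_, ?_⟩ D.nm ?_
      · intro c
        apply Polynomial.natDegree_sum_le_of_forall_le
        intro l _
        exact (Polynomial.natDegree_C_mul_le _ _).trans ((D.isF (Sum.inr l)).1 c)
      · simp only [Finset.sum_mul]
        rw [← Finset.sum_add_distrib]
        apply Finset.sum_congr rfl
        intro l _
        have := (D.isF (Sum.inr l)).2
        simp only at this
        linear_combination Polynomial.C (g l) * this
      · intro c
        refine Polynomial.natDegree_mul_le.trans ?_
        rw [Polynomial.natDegree_X]
        have := hQ.1 c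
        omega
      · have := hQ.2
        linear_combination Polynomial.X * this
      · rw [hg, Finset.mul_sum]
        apply Finset.sum_congr rfl
        intro l _
        rw [D.t2, Polynomial.smul_eq_C_mul]; ring
    refine ⟨Sum.elim ![C ((P 0).coeff 0), C ((P 1).coeff 0)] (fun l => C (g l)), ?_, ?_⟩
    · rintro (i | l)
      · fin_cases i
        · exact isHomogeneous_C _ _
        · exact isHomogeneous_C _ _
      · exact isHomogeneous_C _ _
    · intro c
      rw [hPQ c, ← congrFun hext c]
      simp [Fintype.sum_sum_type, Fin.sum_univ_two]
  | succ e ih =>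
    obtain ⟨Q, hQ, hPQ⟩ := D.sub_step (n + e) (by omega) P hP
    obtain ⟨a, ha, hs⟩ := ih Q hQ
    refine ⟨fun i => Sum.elim ![C ((P 0).coeff 0) * X 1 ^ (e + 1), C ((P 1).coeff 0) * X 1 ^ (e + 1)]
      (fun _ => 0) i + X 0 * a i, ?_, ?_⟩
    · intro i
      refine IsHomogeneous.add ?_ ?_
      · rcases i with i | l
        · fin_cases i
          · simpa using ((isHomogeneous_X_pow (R := ℝ) (1 : Fin 3) (e + 1)).C_mul _)
          · simpa using ((isHomogeneous_X_pow (R := ℝ) (1 : Fin 3) (e + 1)).C_mul _)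
        · exact isHomogeneous_zero _ _ _
      · have := (isHomogeneous_X ℝ (0 : Fin 3)).mul (ha i)
        rwa [add_comm] at this
    · intro c
      have h2 : ∑ i, dl (X 0 * a i) * dl (D.th i c) = Polynomial.X * Q c := by
        rw [← hs c, Finset.mul_sum]
        apply Finset.sum_congr rfl
        intro i _
        rw [map_mul, dl_X0]; ring
      simp only [map_add, add_mul, Finset.sum_add_distrib]
      rw [h2, hPQ c]
      simp [Fintype.sum_sum_type, Fin.sum_univ_two]

lemma comb_apply (a : Fin 2 ⊕ Fin q → S) (c : Fin 3) :
    (∑ i, a i • D.th i) c = ∑ i, a i * D.th i c := by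
  simp [Finset.sum_apply]

lemma comb_mem (a : Fin 2 ⊕ Fin q → S) : (∑ i, a i • D.th i) ∈ Msyz n m :=
  Submodule.sum_mem _ fun i _ => Submodule.smul_mem _ _ (D.mem i)

lemma comb_hom {e : ℕ} {a : Fin 2 ⊕ Fin q → S} (ha : ∀ i, (a i).IsHomogeneous e) (c : Fin 3) :
    ((∑ i, a i • D.th i) c).IsHomogeneous (n + e) := by
  rw [comb_apply]
  apply IsHomogeneous.sum
  intro i _
  rw [add_comm n e]
  exact (ha i).mul (D.hom i c)

lemma div_z {d : ℕ} {t : Fin 3 → S} (ht : t ∈ Msyz n m) (hh : ∀ c, (t c).IsHomogeneous (d + 1))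
    (h : ∀ c, dl (t c) = 0) :
    ∃ r ∈ Msyz n m, (∀ c, (r c).IsHomogeneous d) ∧ t = (X 2 : S) • r := by
  choose r hr hrt using fun c => hom_div (hh c) (h c)
  refine ⟨r, ?_, hr, ?_⟩
  · rw [mem_Msyz] at ht ⊢
    rw [hrt 0, hrt 1, hrt 2] at ht
    apply mul_left_cancel₀ (X_ne_zero (R := ℝ) (2 : Fin 3))
    linear_combination ht
  · funext c
    exact hrt c

lemma claim2 (e : ℕ) (t : Fin 3 → S) (ht : t ∈ Msyz n m) (hh : ∀ c, (t c).IsHomogeneous (n + e)) :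
    ∃ a : Fin 2 ⊕ Fin q → S, (∀ i, (a i).IsHomogeneous e) ∧ t = ∑ i, a i • D.th i := by
  induction e generalizing t with
  | zero =>
    obtain ⟨a, ha, hs⟩ := D.claim1 0 _ (IsF_dl ht hh)
    obtain ⟨d, hd⟩ : ∃ d, n = d + 1 := ⟨n - 1, by have := D.npos; omega⟩
    obtain ⟨r, hr, hrh, hrt⟩ := div_z (d := d) (Submodule.sub_mem _ ht (D.comb_mem a)) (by
      intro c
      rw [← hd]
      exact (hh c).sub (D.comb_hom ha c)) (by
      intro c
      rw [Pi.sub_apply, map_sub, comb_apply, map_sum, ← hs c]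
      simp)
    rw [low_zero n m d (by omega) D.nm r hr hrh, smul_zero] at hrt
    exact ⟨a, ha, sub_eq_zero.1 hrt⟩
  | succ e ih =>
    obtain ⟨a, ha, hs⟩ := D.claim1 (e + 1) _ (IsF_dl ht hh)
    obtain ⟨r, hr, hrh, hrt⟩ := div_z (d := n + e) (Submodule.sub_mem _ ht (D.comb_mem a)) (by
      intro c
      exact (hh c).sub (D.comb_hom ha c)) (by
      intro c
      rw [Pi.sub_apply, map_sub, comb_apply, map_sum, ← hs c]
      simp)
    obtain ⟨b, hb, hbr⟩ := ih r hr hrh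
    refine ⟨fun i => a i + X 2 * b i, ?_, ?_⟩
    · intro i
      refine (ha i).add ?_
      have := (isHomogeneous_X ℝ (2 : Fin 3)).mul (hb i)
      rwa [add_comm] at this
    · rw [sub_eq_iff_eq_add.1 hrt, hbr, Finset.smul_sum, add_comm, ← Finset.sum_add_distrib]
      apply Finset.sum_congr rfl
      intro i _
      rw [add_smul, smul_smul]

end GD

lemma sum_comp (f : S) (N : ℕ) (hN : f.totalDegree < N) :
    ∑ d ∈ Finset.range N, homogeneousComponent d f = f := by
  conv_rhs => rw [← sum_homogeneousComponent f]
  symm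
  apply Finset.sum_subset
  · intro d hd
    rw [Finset.mem_range] at *
    omega
  · intro d _ hd
    apply homogeneousComponent_eq_zero
    rw [Finset.mem_range] at hd
    omega

lemma comp_mem {n m : ℕ} {t : Fin 3 → S} (ht : t ∈ Msyz n m) (d : ℕ) :
    (fun c => homogeneousComponent d (t c)) ∈ Msyz n m := by
  rw [mem_Msyz] at ht ⊢
  have := congrArg (homogeneousComponent (d + m)) ht
  rwa [map_add, comp_mul (pA_hom n m), comp_mul (pB_hom n m), comp_mul (pC_hom n m)] at this

namespace GD

variable {n m q : ℕ} (D : GD n m q)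

lemma generate (t : Fin 3 → S) (ht : t ∈ Msyz n m) :
    ∃ a : Fin 2 ⊕ Fin q → S, t = ∑ i, a i • D.th i := by
  have key : t ∈ Submodule.span S (Set.range D.th) := by
    obtain ⟨N, hN⟩ : ∃ N, ∀ c, (t c).totalDegree < N :=
      ⟨(Finset.univ.sup fun c => (t c).totalDegree) + 1, fun c => by
        have := Finset.le_sup (f := fun c => (t c).totalDegree) (Finset.mem_univ c)
        omega⟩
    have e : t = ∑ d ∈ Finset.range N, fun c => homogeneousComponent d (t c) := by
      funext c
      rw [Finset.sum_apply, sum_comp _ _ (hN c)]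
    rw [e]
    apply Submodule.sum_mem
    intro d _
    by_cases hd : d < n
    · rw [low_zero n m d hd D.nm _ (comp_mem ht d)
        (fun c => homogeneousComponent_isHomogeneous d (t c))]
      exact Submodule.zero_mem _
    · obtain ⟨e, rfl⟩ : ∃ e, d = n + e := ⟨d - n, by omega⟩
      obtain ⟨a, -, ha⟩ := D.claim2 e _ (comp_mem ht _)
        (fun c => homogeneousComponent_isHomogeneous (n + e) (t c))
      rw [ha]
      exact Submodule.sum_mem _ fun i _ =>
        Submodule.smul_mem _ _ (Submodule.subset_span ⟨i, rfl⟩)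
  obtain ⟨a, ha⟩ := (Submodule.mem_span_range_iff_exists_fun S).1 key
  exact ⟨a, ha.symm⟩

/-- The linear relations. -/
lemma rel (l : Fin q) : ∃ a b : Fin 2 ⊕ Fin q → S, (∀ i, (a i).IsHomogeneous 0) ∧
    (∀ i, (b i).IsHomogeneous 0) ∧
    (X 1 : S) • D.th (Sum.inr l) =
      (X 0 : S) • (∑ i, a i • D.th i) + (X 2 : S) • (∑ i, b i • D.th i) := by
  obtain ⟨d, hd⟩ : ∃ d, n = d + 1 := ⟨n - 1, by have := D.npos; omega⟩
  obtain ⟨Q, hQ, hPQ⟩ := ((D.isF (Sum.inr l)).mono hd.le).div D.mpos (D.t0 l) (D.t1 l)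
  obtain ⟨a, ha, hs⟩ := D.claim1 0 Q (hQ.mono (by omega))
  have hd' : ∀ c, dl (((X 1 : S) • D.th (Sum.inr l) - (X 0 : S) • (∑ i, a i • D.th i)) c) = 0 := by
    intro c
    have h1 := hPQ c
    rw [Pi.sub_apply, Pi.smul_apply, Pi.smul_apply, smul_eq_mul, smul_eq_mul, comb_apply, map_sub,
      map_mul, map_mul, map_sum, dl_X1, dl_X0, one_mul, h1, ← hs c]
    simp
  obtain ⟨r, hr, hrh, hrt⟩ := div_z (d := n) (Submodule.sub_mem _
    (Submodule.smul_mem _ (X 1 : S) (D.mem (Sum.inr l)))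
    (Submodule.smul_mem _ (X 0 : S) (D.comb_mem a))) (by
      intro c
      refine IsHomogeneous.sub ?_ ?_
      · rw [add_comm]
        exact (isHomogeneous_X ℝ (1 : Fin 3)).mul (D.hom _ c)
      · rw [add_comm]
        exact (isHomogeneous_X ℝ (0 : Fin 3)).mul (D.comb_hom ha c)) hd'
  obtain ⟨b, hb, hbr⟩ := D.claim2 0 r hr hrh
  refine ⟨a, b, ha, hb, ?_⟩
  rw [← hbr, ← hrt]
  abel

end GD
/-! ### The relations -/

/-- Generators together with their linear relations. -/
structure RD (n m q : ℕ) extends GD n m q where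
  ra : Fin q → Fin 2 ⊕ Fin q → S
  rb : Fin q → Fin 2 ⊕ Fin q → S
  ra_hom : ∀ l i, (ra l i).IsHomogeneous 0
  rb_hom : ∀ l i, (rb l i).IsHomogeneous 0
  rel_eq : ∀ l, (X 1 : S) • th (Sum.inr l) =
      (X 0 : S) • (∑ i, ra l i • th i) + (X 2 : S) • (∑ i, rb l i • th i)

lemma RD_exists (n m j k : ℕ) (hn : n = k + j) (hm : m = k + 2 * j + 1) (hk : 1 ≤ k) :
    Nonempty (RD n m (k - 1)) := by
  obtain ⟨D⟩ := GD_exists n m j k hn hm hk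
  choose a b ha hb h using D.rel
  exact ⟨{ D with ra := a, rb := b, ra_hom := ha, rb_hom := hb, rel_eq := h }⟩

namespace RD

variable {n m q : ℕ} (D : RD n m q)

/-- The relation matrix. -/
def Mx : Matrix (Fin 2 ⊕ Fin q) (Fin q) S :=
  fun i l => (if i = Sum.inr l then X 1 else 0) - X 0 * D.ra l i - X 2 * D.rb l i

lemma Mx_hom (i : Fin 2 ⊕ Fin q) (l : Fin q) : (D.Mx i l).IsHomogeneous 1 := by
  refine IsHomogeneous.sub (IsHomogeneous.sub ?_ ?_) ?_
  · split_ifs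
    · exact isHomogeneous_X _ _
    · exact isHomogeneous_zero _ _ _
  · exact (isHomogeneous_X ℝ (0 : Fin 3)).mul (D.ra_hom l i)
  · exact (isHomogeneous_X ℝ (2 : Fin 3)).mul (D.rb_hom l i)

lemma Mx_col (l : Fin q) : ∑ i, D.Mx i l • D.th i = 0 := by
  have h := D.rel_eq l
  have e : ∑ i, D.Mx i l • D.th i = (X 1 : S) • D.th (Sum.inr l) -
      (X 0 : S) • (∑ i, D.ra l i • D.th i) - (X 2 : S) • (∑ i, D.rb l i • D.th i) := by
    simp only [Mx, sub_smul, Finset.sum_sub_distrib, Finset.smul_sum, smul_smul, ite_smul, zero_smul,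
      Finset.sum_ite_eq', Finset.mem_univ, if_true]
  rw [e, h]
  abel

lemma Mx_rel (v : Fin q → S) : ∑ i, (D.Mx.mulVec v) i • D.th i = 0 := by
  have : ∑ i, (D.Mx.mulVec v) i • D.th i = ∑ l, v l • ∑ i, D.Mx i l • D.th i := by
    simp only [Matrix.mulVec, dotProduct, Finset.sum_smul, Finset.smul_sum, smul_smul]
    rw [Finset.sum_comm]
    simp only [mul_comm]
  rw [this]
  simp only [Mx_col, smul_zero, Finset.sum_const_zero]

lemma Mx_mulVec_hom {e : ℕ} {v : Fin q → S} (hv : ∀ l, (v l).IsHomogeneous e)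
    (i : Fin 2 ⊕ Fin q) : ((D.Mx.mulVec v) i).IsHomogeneous (e + 1) := by
  simp only [Matrix.mulVec, dotProduct]
  apply IsHomogeneous.sum
  intro l _
  rw [add_comm]
  exact (D.Mx_hom i l).mul (hv l)

lemma Mx_inj : Function.Injective D.Mx.mulVec := by
  have key : ∀ v, D.Mx.mulVec v = 0 → v = 0 := by
    intro v hv
    let T : Matrix (Fin q) (Fin q) S := fun l' l => D.Mx (Sum.inr l') l
    have hT : T.det ≠ 0 := by
      intro h
      have h1 := congrArg (eval (![0, 1, 0] : Fin 3 → ℝ)) h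
      rw [RingHom.map_det, map_zero] at h1
      have : (eval (![0, 1, 0] : Fin 3 → ℝ)).mapMatrix T = 1 := by
        ext a b
        change eval (![0, 1, 0] : Fin 3 → ℝ) (D.Mx (Sum.inr a) b) = (1 : Matrix _ _ ℝ) a b
        by_cases hab : a = b
        · subst hab; simp [Mx]
        · simp [Mx, hab]
      rw [this, Matrix.det_one] at h1
      exact one_ne_zero h1
    apply Matrix.eq_zero_of_mulVec_eq_zero hT
    funext l
    exact congrFun hv (Sum.inr l)
  intro v w h
  have := key (v - w) (by rw [Matrix.mulVec_sub, h, sub_self])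
  exact sub_eq_zero.1 this

lemma coeff_sigma {a : Fin 2 ⊕ Fin q → Polynomial ℝ}
    (h : ∀ c, ∑ i, a i * dl (D.th i c) = 0) (s : Fin 2) : (a (Sum.inl s)).coeff 0 = 0 := by
  have h0 := congrArg (fun f => Polynomial.coeff f 0) (h 0)
  have h1 := congrArg (fun f => Polynomial.coeff f 0) (h 1)
  simp only [Fintype.sum_sum_type, Fin.sum_univ_two, Polynomial.coeff_add,
    Polynomial.finsetSum_coeff, Polynomial.mul_coeff_zero, D.s00, D.s01, D.s10, D.s11, D.t0, D.t1,
    mul_zero, mul_one, Finset.sum_const_zero, add_zero, zero_add, Polynomial.coeff_zero] at h0 h1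
  fin_cases s
  · exact h0
  · exact h1

lemma dl_rel (v : Fin q → S) (c : Fin 3) :
    ∑ i, dl ((D.Mx.mulVec v) i) * dl (D.th i c) = 0 := by
  have h := congrFun (D.Mx_rel v) c
  rw [D.comb_apply] at h
  have := congrArg dl h
  simpa [map_sum] using this

lemma claim3 (e : ℕ) (a : Fin 2 ⊕ Fin q → S) (ha : ∀ i, (a i).IsHomogeneous e)
    (h : ∀ c, ∑ i, dl (a i) * dl (D.th i c) = 0) :
    ∃ v : Fin q → S, (∀ l, (v l).IsHomogeneous (e - 1)) ∧ (e = 0 → v = 0) ∧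
      ∀ i, dl (a i) = dl ((D.Mx.mulVec v) i) := by
  induction e generalizing a with
  | zero =>
    refine ⟨0, fun l => isHomogeneous_zero _ _ _, fun _ => rfl, ?_⟩
    choose r hr using fun i => hom_zero_const (ha i)
    have hs := D.coeff_sigma h
    have hs' : ∀ s, r (Sum.inl s) = 0 := by
      intro s
      have := hs s
      rw [hr] at this
      simpa using this
    have h2 := h 2
    simp only [Fintype.sum_sum_type, hr, hs', D.t2, dl_C, map_zero, zero_mul,
      Finset.sum_const_zero, zero_add] at h2
    have h3 : Polynomial.X * ∑ l, r (Sum.inr l) • D.tp l = 0 := by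
      rw [← h2, Finset.mul_sum]
      apply Finset.sum_congr rfl
      intro l _
      rw [Polynomial.smul_eq_C_mul]; ring
    have h4 := D.indep _ ((mul_eq_zero.1 h3).resolve_left Polynomial.X_ne_zero)
    rintro (s | l)
    · rw [hr, hs']; simp
    · rw [hr, h4]; simp
  | succ e ih =>
    set v0 : Fin q → S := fun l => C ((dl (a (Sum.inr l))).coeff 0) * X 1 ^ e with hv0
    have hv0h : ∀ l, (v0 l).IsHomogeneous e := by
      intro l
      simpa using ((isHomogeneous_X_pow (R := ℝ) (1 : Fin 3) e).C_mul _)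
    have hrel : ∀ c, ∑ i, (dl (a i) - dl ((D.Mx.mulVec v0) i)) * dl (D.th i c) = 0 := by
      intro c
      simp only [sub_mul, Finset.sum_sub_distrib]
      rw [h c, D.dl_rel v0 c, sub_zero]
    have hz : ∀ i, (dl (a i) - dl ((D.Mx.mulVec v0) i)).coeff 0 = 0 := by
      rintro (s | l)
      · exact D.coeff_sigma hrel s
      · have : (dl ((D.Mx.mulVec v0) (Sum.inr l))).coeff 0 = (dl (a (Sum.inr l))).coeff 0 := by
          simp only [Matrix.mulVec, dotProduct, map_sum, Polynomial.finsetSum_coeff]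
          rw [Finset.sum_eq_single l]
          · simp [Mx, hv0]
          · intro b _ hb
            simp [Mx, hv0, Ne.symm hb]
          · simp
        rw [Polynomial.coeff_sub, this, sub_self]
    have hdeg : ∀ i, (dl (a i) - dl ((D.Mx.mulVec v0) i)).natDegree ≤ e + 1 := by
      intro i
      exact (Polynomial.natDegree_sub_le _ _).trans (max_le (dl_natDegree (ha i))
        (dl_natDegree (D.Mx_mulVec_hom hv0h i)))
    choose g hg hgX using fun i => eq_X_mul (hdeg i) (hz i)
    obtain ⟨v', hv', hv'0, hv'e⟩ := ih (fun i => lum 0 (X 0) (X 1) e (g i))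
      (fun i => lum_hom (isHomogeneous_zero _ _ _) (isHomogeneous_X _ _) (isHomogeneous_X _ _) _ _)
      (by
        intro c
        have h1 := hrel c
        apply mul_left_cancel₀ (Polynomial.X_ne_zero (R := ℝ))
        rw [mul_zero, ← h1, Finset.mul_sum]
        apply Finset.sum_congr rfl
        intro i _
        rw [dl_lum (by simp) (by simp) (by simp) _ _ (hg i), hgX]
        ring)
    refine ⟨v0 + (X 0 : S) • v', ?_, by omega, ?_⟩
    · intro l
      refine IsHomogeneous.add (hv0h l) ?_
      change (X 0 * v' l).IsHomogeneous (e + 1 - 1)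
      rcases Nat.eq_zero_or_pos e with he | he
      · rw [hv'0 he]
        simpa using isHomogeneous_zero (Fin 3) ℝ _
      · have := (isHomogeneous_X ℝ (0 : Fin 3)).mul (hv' l)
        rwa [show 1 + (e - 1) = e + 1 - 1 by omega] at this
    · intro i
      have h1 := hv'e i
      rw [dl_lum (by simp) (by simp) (by simp) _ _ (hg i)] at h1
      rw [Matrix.mulVec_add, Matrix.mulVec_smul, Pi.add_apply, Pi.smul_apply, smul_eq_mul, map_add,
        map_mul, dl_X0, ← h1, ← hgX]
      ring

lemma claim4 (e : ℕ) (a : Fin 2 ⊕ Fin q → S) (ha : ∀ i, (a i).IsHomogeneous e)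
    (h : ∑ i, a i • D.th i = 0) : ∃ v : Fin q → S, D.Mx.mulVec v = a := by
  have hdl : ∀ c, ∑ i, dl (a i) * dl (D.th i c) = 0 := by
    intro c
    have h1 := congrFun h c
    rw [D.comb_apply] at h1
    have := congrArg dl h1
    simpa [map_sum] using this
  induction e generalizing a with
  | zero =>
    obtain ⟨v, hv, hv0, hve⟩ := D.claim3 0 a ha hdl
    refine ⟨0, ?_⟩
    rw [Matrix.mulVec_zero]
    funext i
    symm
    apply hom_zero (ha i)
    rw [hve, hv0 rfl]
    simp
  | succ e ih =>
    obtain ⟨v, hv, -, hve⟩ := D.claim3 (e + 1) a ha hdl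
    choose b hb hbe using fun i => hom_div (f := a i - (D.Mx.mulVec v) i) (d := e)
      ((ha i).sub (D.Mx_mulVec_hom hv i)) (by rw [map_sub, hve, sub_self])
    have hb0 : ∑ i, b i • D.th i = 0 := by
      have h1 : (X 2 : S) • ∑ i, b i • D.th i = 0 := by
        rw [Finset.smul_sum]
        simp only [smul_smul, ← hbe, sub_smul, Finset.sum_sub_distrib]
        rw [h, D.Mx_rel, sub_zero]
      exact (smul_eq_zero.1 h1).resolve_left (X_ne_zero _)
    obtain ⟨w, hw⟩ := ih b hb hb0 (by
      intro c
      have h1 := congrFun hb0 c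
      rw [D.comb_apply] at h1
      have := congrArg dl h1
      simpa [map_sum] using this)
    refine ⟨v + (X 2 : S) • w, ?_⟩
    funext i
    rw [Matrix.mulVec_add, Matrix.mulVec_smul, hw, Pi.add_apply, Pi.smul_apply, smul_eq_mul, ← hbe]
    ring

lemma kernel (a : Fin 2 ⊕ Fin q → S) (h : ∑ i, a i • D.th i = 0) :
    ∃ v : Fin q → S, D.Mx.mulVec v = a := by
  have key : a ∈ LinearMap.range D.Mx.mulVecLin := by
    obtain ⟨N, hN⟩ : ∃ N, ∀ c, (a c).totalDegree < N :=
      ⟨(Finset.univ.sup fun c => (a c).totalDegree) + 1, fun c => by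
        have := Finset.le_sup (f := fun c => (a c).totalDegree) (Finset.mem_univ c)
        omega⟩
    have e : a = ∑ d ∈ Finset.range N, fun c => homogeneousComponent d (a c) := by
      funext c
      rw [Finset.sum_apply, sum_comp _ _ (hN c)]
    rw [e]
    apply Submodule.sum_mem
    intro d _
    obtain ⟨v, hv⟩ := D.claim4 d (fun c => homogeneousComponent d (a c))
      (fun c => homogeneousComponent_isHomogeneous d (a c)) (by
        funext c
        have h1 := congrFun h c
        rw [D.comb_apply] at h1 ⊢
        have h2 := congrArg (homogeneousComponent (d + n)) h1
        rw [map_sum] at h2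
        simp only [fun i => comp_mul (D.hom i c) (a i) d] at h2
        rw [h2]
        simp)
    exact ⟨v, hv⟩
  obtain ⟨v, hv⟩ := key
  exact ⟨v, hv⟩

end RD

/-- The resolution of the syzygy module. -/
lemma core (n m j k : ℕ) (hn : n = k + j) (hm : m = k + 2 * j + 1) (hk : 2 ≤ k) :
    ∃ (t : Fin (k + 1) → (Fin 3 → S)) (M : Matrix (Fin (k + 1)) (Fin (k - 1)) S),
      (∀ i, t i ∈ Msyz n m) ∧ (∀ i c, (t i c).IsHomogeneous n) ∧
      (∀ i l, (M i l).IsHomogeneous 1) ∧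
      (∀ s ∈ Msyz n m, ∃ a : Fin (k + 1) → S, s = ∑ i, a i • t i) ∧
      Function.Injective M.mulVec ∧
      (∀ a : Fin (k + 1) → S, (∑ i, a i • t i) = 0 ↔ ∃ v : Fin (k - 1) → S, M.mulVec v = a) := by
  obtain ⟨D⟩ := RD_exists n m j k hn hm (by omega)
  let ε : Fin (k + 1) ≃ Fin 2 ⊕ Fin (k - 1) :=
    (finCongr (by omega : k + 1 = 2 + (k - 1))).trans finSumFinEquiv.symm
  have hsum : ∀ a : Fin (k + 1) → S, ∑ i, a i • D.th (ε i) = ∑ i, a (ε.symm i) • D.th i := by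
    intro a
    rw [← Equiv.sum_comp ε]
    simp
  have hmv : ∀ v, (D.Mx.submatrix ε id).mulVec v = (D.Mx.mulVec v) ∘ ε := by
    intro v
    rfl
  refine ⟨fun i => D.th (ε i), D.Mx.submatrix ε id, fun i => D.mem _, fun i => D.hom _,
    fun i l => D.Mx_hom _ _, ?_, ?_, ?_⟩
  · intro s hs
    obtain ⟨a, ha⟩ := D.generate s hs
    refine ⟨a ∘ ε, ?_⟩
    rw [hsum, ha]
    simp
  · intro v w h
    apply D.Mx_inj
    rw [hmv, hmv] at h
    exact ε.surjective.injective_comp_right h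
  · intro a
    rw [hsum]
    constructor
    · intro h
      obtain ⟨v, hv⟩ := D.kernel _ h
      refine ⟨v, ?_⟩
      rw [hmv, hv]
      funext i
      simp
    · rintro ⟨v, rfl⟩
      have := D.Mx_rel v
      rw [hmv]
      simpa using this
/-! ### From syzygies to derivations -/

/-- The Euler derivation. -/
def Eul : Derivation ℝ S S := ∑ i : Fin 3, (X i : S) • pderiv i

lemma Eul_hom {f : S} {d : ℕ} (hf : f.IsHomogeneous d) : Eul f = (d : S) * f := by
  have := hf.sum_X_mul_pderiv
  rw [nsmul_eq_mul] at this
  rw [← this]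
  simp [Eul, Fin.sum_univ_three]

lemma Eul_X (i : Fin 3) : Eul (X i : S) = X i := by
  rw [Eul_hom (isHomogeneous_X ℝ i)]; simp

lemma der_ff (D : Derivation ℝ S S) {ε u : S} (hε : D ε = 0) (hu : D u = 0) (i : ℕ) :
    D (ff ε u i) = 0 := by
  induction i with
  | zero => simp [ff_zero]
  | succ i ih =>
    rw [ff_succ, D.leibniz, ih, map_sub, D.leibniz, hu, hε]
    simp

/-- The product of all linear forms. -/
def FF (n m : ℕ) : S := X 2 * (pA n m * pB n m * pC n m)

lemma FF_hom (n m : ℕ) : (FF n m).IsHomogeneous (3 * m + 1) := by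
  have := (isHomogeneous_X ℝ (2 : Fin 3)).mul (((pA_hom n m).mul (pB_hom n m)).mul (pC_hom n m))
  rwa [show 1 + (m + m + m) = 3 * m + 1 by ring] at this

/-- The logarithmic multiplier. -/
def hh (n m : ℕ) : (Fin 3 → S) →ₗ[S] S where
  toFun t := t 0 * pderiv 0 (pA n m) + t 1 * pderiv 1 (pB n m) + t 2 * pderiv 0 (pC n m)
  map_add' a b := by simp only [Pi.add_apply]; ring
  map_smul' c a := by simp only [Pi.smul_apply, smul_eq_mul, RingHom.id_apply]; ring

/-- The derivation `t₀ A ∂x + t₁ B ∂y`. -/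
def eta (n m : ℕ) : (Fin 3 → S) →ₗ[S] Derivation ℝ S S where
  toFun t := (t 0 * pA n m) • pderiv 0 + (t 1 * pB n m) • pderiv 1
  map_add' a b := by
    simp only [Pi.add_apply, add_mul, add_smul]; abel
  map_smul' c a := by
    simp only [Pi.smul_apply, smul_eq_mul, RingHom.id_apply, smul_add, smul_smul, mul_assoc]

lemma eta_apply (n m : ℕ) (t : Fin 3 → S) (p : S) :
    eta n m t p = t 0 * pA n m * pderiv 0 p + t 1 * pB n m * pderiv 1 p := rfl

/-- The derivation attached to a syzygy. -/
def Th (n m : ℕ) : (Fin 3 → S) →ₗ[S] Derivation ℝ S S where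
  toFun t := eta n m t - (C ((3 * m + 1 : ℕ) : ℝ)⁻¹ * hh n m t) • Eul
  map_add' a b := by
    simp only [map_add, mul_add, add_smul]; abel
  map_smul' c a := by
    rw [map_smul, map_smul, RingHom.id_apply, smul_sub, smul_smul, smul_eq_mul, mul_left_comm]

lemma Th_apply (n m : ℕ) (t : Fin 3 → S) (p : S) :
    Th n m t p = eta n m t p - C ((3 * m + 1 : ℕ) : ℝ)⁻¹ * (hh n m t * Eul p) := by
  rw [← mul_assoc]; rfl

lemma eta_FF {n m : ℕ} {t : Fin 3 → S} (ht : t ∈ Msyz n m) :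
    eta n m t (FF n m) = hh n m t * FF n m := by
  have hn0 : ∀ i, i ≠ 2 → pderiv i ((n : S) * X 2) = 0 := by
    intro i hi
    simp [pderiv_X_of_ne hi.symm]
  have hA : pderiv 1 (pA n m) = 0 :=
    der_ff _ (by simp [pderiv_X_of_ne]) (by
      rw [map_sub, hn0 1 (by decide), pderiv_X_of_ne (by decide), sub_zero]) m
  have hB : pderiv 0 (pB n m) = 0 :=
    der_ff _ (by simp [pderiv_X_of_ne]) (by
      rw [map_sub, hn0 0 (by decide), pderiv_X_of_ne (by decide), sub_zero]) m
  have hC : pderiv 0 (pC n m) - pderiv 1 (pC n m) = 0 :=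
    der_ff (pderiv 0 - pderiv 1 : Derivation ℝ S S) (by simp [pderiv_X_of_ne]) (by
      rw [Derivation.sub_apply, map_sub, map_sub, hn0 0 (by decide), hn0 1 (by decide), map_add,
        map_add, pderiv_X_self, pderiv_X_self, pderiv_X_of_ne (by decide),
        pderiv_X_of_ne (by decide)]
      ring) m
  have h2 : ∀ i : Fin 3, i ≠ 2 → pderiv i (X 2 : S) = 0 := fun i hi => pderiv_X_of_ne hi.symm
  rw [eta_apply]
  simp only [FF, Derivation.leibniz, smul_eq_mul, hA, hB, h2 0 (by decide), h2 1 (by decide)]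
  rw [mem_Msyz] at ht
  change _ = (t 0 * pderiv 0 (pA n m) + t 1 * pderiv 1 (pB n m) + t 2 * pderiv 0 (pC n m)) * _
  have hC' : pderiv 1 (pC n m) = pderiv 0 (pC n m) := (sub_eq_zero.1 hC).symm
  rw [hC']
  linear_combination (X 2 * pA n m * pB n m * pderiv 0 (pC n m)) * ht

lemma Th_mem {n m : ℕ} {t : Fin 3 → S} (ht : t ∈ Msyz n m) : Th n m t (FF n m) = 0 := by
  rw [Th_apply, eta_FF ht, Eul_hom (FF_hom n m)]
  have : (C ((3 * m + 1 : ℕ) : ℝ)⁻¹ : S) * ((3 * m + 1 : ℕ) : S) = 1 := by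
    rw [← map_natCast (C : ℝ →+* S), ← map_mul, inv_mul_cancel₀ (by positivity), map_one]
  linear_combination -(hh n m t * FF n m) * this

lemma pA_ne {n m : ℕ} : pA n m ≠ 0 := by
  intro h
  have := congrArg dl h
  rw [dl_pA, map_zero] at this
  exact pow_ne_zero _ Polynomial.X_ne_zero this

lemma pB_ne {n m : ℕ} : pB n m ≠ 0 := by
  intro h
  have := congrArg dl h
  rw [dl_pB, map_zero] at this
  exact one_ne_zero this

lemma pC_ne {n m : ℕ} : pC n m ≠ 0 := by
  intro h
  have := congrArg dl h
  rw [dl_pC, map_zero] at this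
  exact one_add_X_ne_zero m this

lemma FF_ne {n m : ℕ} : FF n m ≠ 0 :=
  mul_ne_zero (X_ne_zero _) (mul_ne_zero (mul_ne_zero pA_ne pB_ne) pC_ne)

lemma Th_inj {n m : ℕ} {t : Fin 3 → S} (ht : t ∈ Msyz n m) (h : Th n m t = 0) : t = 0 := by
  have hc : (C ((3 * m + 1 : ℕ) : ℝ)⁻¹ : S) ≠ 0 := by
    rw [Ne, C_eq_zero]
    positivity
  have h2 : hh n m t = 0 := by
    have := congrArg (fun D : Derivation ℝ S S => D (X 2)) h
    simp only [Th_apply, eta_apply, Eul_X, Derivation.zero_apply] at this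
    rw [pderiv_X_of_ne (by decide), pderiv_X_of_ne (by decide)] at this
    have h3 : C ((3 * m + 1 : ℕ) : ℝ)⁻¹ * (hh n m t * X 2) = 0 := by linear_combination -this
    exact (mul_eq_zero.1 ((mul_eq_zero.1 h3).resolve_left hc)).resolve_right (X_ne_zero _)
  have h0 : t 0 = 0 := by
    have := congrArg (fun D : Derivation ℝ S S => D (X 0)) h
    simp only [Th_apply, eta_apply, Derivation.zero_apply, h2] at this
    rw [pderiv_X_self, pderiv_X_of_ne (by decide)] at this
    have h3 : t 0 * pA n m = 0 := by linear_combination this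
    exact (mul_eq_zero.1 h3).resolve_right pA_ne
  have h1 : t 1 = 0 := by
    have := congrArg (fun D : Derivation ℝ S S => D (X 1)) h
    simp only [Th_apply, eta_apply, Derivation.zero_apply, h2] at this
    rw [pderiv_X_self, pderiv_X_of_ne (by decide)] at this
    have h3 : t 1 * pB n m = 0 := by linear_combination this
    exact (mul_eq_zero.1 h3).resolve_right pB_ne
  rw [mem_Msyz, h0, h1] at ht
  have h3 : t 2 * pC n m = 0 := by linear_combination -ht
  have h4 := (mul_eq_zero.1 h3).resolve_right pC_ne
  funext i
  fin_cases i
  · exact h0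
  · exact h1
  · exact h4

lemma Th_hom {n m : ℕ} (hm : 0 < m) {t : Fin 3 → S} (ht : ∀ i, (t i).IsHomogeneous n) :
    IsHomogDer (Th n m t) (n + m) := by
  have hhom : (hh n m t).IsHomogeneous (n + (m - 1)) :=
    (((ht 0).mul (pA_hom n m).pderiv).add ((ht 1).mul (pB_hom n m).pderiv)).add
      ((ht 2).mul (pC_hom n m).pderiv)
  intro i
  rw [Th_apply, eta_apply, Eul_X]
  refine IsHomogeneous.sub (IsHomogeneous.add ?_ ?_) ?_
  · have : (pderiv 0 (X i : S)).IsHomogeneous 0 := (isHomogeneous_X ℝ i).pderiv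
    exact ((ht 0).mul (pA_hom n m)).mul this
  · have : (pderiv 1 (X i : S)).IsHomogeneous 0 := (isHomogeneous_X ℝ i).pderiv
    exact ((ht 1).mul (pB_hom n m)).mul this
  · have := (hhom.mul (isHomogeneous_X ℝ i)).C_mul (((3 * m + 1 : ℕ) : ℝ)⁻¹)
    rwa [show n + (m - 1) + 1 = n + m by omega] at this

/-! ### Surjectivity -/

lemma prod_dvd_fam {i : Fin 3} {g : ℕ → S} (hinj : Function.Injective g)
    (hg : ∀ s s', sb i (g s) (g s') = g s') (p : S) (T : Finset ℕ)
    (h : ∀ s ∈ T, X i - g s ∣ p) : ∏ s ∈ T, (X i - g s) ∣ p := by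
  classical
  induction T using Finset.induction_on with
  | empty => simp
  | insert s T hs ih =>
    obtain ⟨r, hr⟩ := ih (fun s' hs' => h s' (Finset.mem_insert_of_mem hs'))
    have h1 : sb i (g s) p = 0 := sb_of_dvd (by rw [map_sub, sb_X_self, hg, sub_self])
      (h s (Finset.mem_insert_self _ _))
    rw [hr, map_mul, map_prod] at h1
    have h2 : sb i (g s) r = 0 := by
      refine (mul_eq_zero.1 h1).resolve_left (Finset.prod_ne_zero_iff.2 ?_)
      intro s' hs'
      rw [map_sub, sb_X_self, hg, sub_ne_zero]
      intro he
      rw [hinj he] at hs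
      exact hs hs'
    obtain ⟨r', hr'⟩ := dvd_of_sb h2
    refine ⟨r', ?_⟩
    rw [Finset.prod_insert hs, hr, hr']
    ring

lemma log_factor (θ : Derivation ℝ S S) {i : Fin 3} {g G : S} (hg : sb i g g = g)
    (hG : sb i g G ≠ 0) (h : θ ((X i - g) * G) = 0) : X i - g ∣ θ (X i - g) := by
  apply dvd_of_sb
  have h1 := congrArg (sb i g) h
  rw [θ.leibniz, smul_eq_mul, smul_eq_mul, map_add, map_mul, map_mul, map_zero, map_sub, sb_X_self,
    hg, sub_self, zero_mul, zero_add] at h1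
  exact (mul_eq_zero.1 h1).resolve_left hG

lemma log_fam (θ : Derivation ℝ S S) {i : Fin 3} {g : ℕ → S} (hinj : Function.Injective g)
    (hg : ∀ s s', sb i (g s) (g s') = g s') {m : ℕ} {P R : S}
    (hP : P = ∏ s ∈ Finset.range m, (X i - g s)) (hR : ∀ s, sb i (g s) R ≠ 0)
    (h : θ (P * R) = 0) : ∀ s ∈ Finset.range m, X i - g s ∣ θ (X i - g s) := by
  intro s hs
  apply log_factor θ (G := (∏ s' ∈ (Finset.range m).erase s, (X i - g s')) * R) (hg s s)
  · rw [map_mul, map_prod]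
    refine mul_ne_zero (Finset.prod_ne_zero_iff.2 ?_) (hR s)
    intro s' hs'
    rw [map_sub, sb_X_self, hg, sub_ne_zero]
    intro he
    exact (Finset.ne_of_mem_erase hs') (hinj he).symm
  · rw [← mul_assoc, Finset.mul_prod_erase _ (fun s' => X i - g s') hs, ← hP]
    exact h

/-- The constants `n - s`. -/
def rr (n s : ℕ) : ℝ := (n : ℝ) - s

lemma rr_inj (n : ℕ) : Function.Injective (rr n) := by
  intro a b h
  have : (a : ℝ) = b := by simp only [rr] at h; linarith
  exact_mod_cast this

lemma pA_eq (n m : ℕ) : pA n m = ∏ s ∈ Finset.range m, (X 0 - C (rr n s) * X 2) := by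
  rw [pA, ff]
  apply Finset.prod_congr rfl
  intro s _
  simp only [rr, map_sub, map_natCast]; ring

lemma pB_eq (n m : ℕ) : pB n m = ∏ s ∈ Finset.range m, (X 1 - C (rr n s) * X 2) := by
  rw [pB, ff]
  apply Finset.prod_congr rfl
  intro s _
  simp only [rr, map_sub, map_natCast]; ring

lemma pC_eq (n m : ℕ) : pC n m = ∏ s ∈ Finset.range m, (X 0 - (C (rr n s) * X 2 - X 1)) := by
  rw [pC, ff]
  apply Finset.prod_congr rfl
  intro s _
  simp only [rr, map_sub, map_natCast]; ring

lemma fjk_eq (j k : ℕ) : fjk j k = FF (k + j) (k + 2 * j + 1) := by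
  rw [fjk, FF, pA_eq, pB_eq, pC_eq, ← Finset.prod_mul_distrib, ← Finset.prod_mul_distrib]
  congr 1
  symm
  refine Finset.prod_bij (fun s _ => ((k + j : ℕ) : ℤ) - s) ?_ ?_ ?_ ?_
  · intro s hs
    rw [Finset.mem_range] at hs
    rw [Finset.mem_Icc]
    push_cast
    omega
  · intro a _ b _ h
    simpa using h
  · intro b hb
    rw [Finset.mem_Icc] at hb
    refine ⟨(((k + j : ℕ) : ℤ) - b).toNat, ?_, ?_⟩
    · rw [Finset.mem_range]; omega
    · push_cast; omega
  · intro s _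
    have : ((((k + j : ℕ) : ℤ) - s : ℤ) : ℝ) = rr (k + j) s := by
      simp [rr]
    rw [this]; ring

lemma ne_of_eval {f : S} (p : Fin 3 → ℝ) (h : eval p f ≠ 0) : f ≠ 0 := by
  rintro rfl
  simp at h

lemma CX_inj (n : ℕ) : Function.Injective (fun s => (C (rr n s) * X 2 : S)) := by
  intro a b h
  have := mul_right_cancel₀ (X_ne_zero (R := ℝ) (2 : Fin 3)) h
  exact rr_inj n (C_injective _ _ this)

lemma sb_lin (i : Fin 3) (g : S) (hi : i ≠ 2) (r : ℝ) : sb i g (C r * X 2) = C r * X 2 := by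
  rw [map_mul, sb_C, sb_X_ne hi.symm]

lemma Th_surj {n m : ℕ} (θ : Derivation ℝ S S) (h : θ (FF n m) = 0) :
    ∃ t ∈ Msyz n m, Th n m t = θ := by
  -- divisibility by `z`
  have hz : (X 2 : S) ∣ θ (X 2) := by
    have := log_factor θ (i := 2) (g := 0) (G := pA n m * pB n m * pC n m) (by simp) (by
      rw [map_mul, map_mul, pA_eq, pB_eq, pC_eq, map_prod, map_prod, map_prod]
      refine mul_ne_zero (mul_ne_zero ?_ ?_) ?_ <;> rw [Finset.prod_ne_zero_iff] <;> intro s _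
      · apply ne_of_eval ![1, 0, 0]
        simp [sb]
      · apply ne_of_eval ![0, 1, 0]
        simp [sb]
      · apply ne_of_eval ![1, 0, 0]
        simp [sb]) (by rw [sub_zero]; exact h)
    simpa using this
  obtain ⟨w, hw⟩ := hz
  set η : Derivation ℝ S S := θ - w • Eul with hη
  have hηa : ∀ p, η p = θ p - w * Eul p := fun p => rfl
  have hη2 : η (X 2) = 0 := by rw [hηa, hw, Eul_X]; ring
  have hηC : ∀ r : ℝ, η (C r * X 2) = 0 := by
    intro r
    rw [η.leibniz, hη2, ← algebraMap_eq, η.map_algebraMap]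
    simp
  have hEl : ∀ (g : S) (i : Fin 3), g.IsHomogeneous 1 → X i - g ∣ θ (X i - g) →
      X i - g ∣ η (X i - g) := by
    intro g i hg hd
    rw [hηa, Eul_hom ((isHomogeneous_X ℝ i).sub hg)]
    exact dvd_sub hd (Dvd.intro_left (w * ((1 : ℕ) : S)) (by ring))
  have hCh : ∀ r : ℝ, (C r * X 2 : S).IsHomogeneous 1 := fun r => (isHomogeneous_X ℝ 2).C_mul r
  have hA : pA n m ∣ η (X 0) := by
    rw [pA_eq]
    apply prod_dvd_fam (CX_inj n) (fun s s' => sb_lin 0 _ (by decide) _)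
    intro s hs
    have h1 := log_fam θ (i := 0) (CX_inj n) (fun s s' => sb_lin 0 _ (by decide) _) (m := m)
      (R := X 2 * (pB n m * pC n m)) (pA_eq n m) (by
        intro s
        rw [map_mul, map_mul, pB_eq, pC_eq, map_prod, map_prod]
        refine mul_ne_zero ?_ (mul_ne_zero ?_ ?_)
        · rw [sb_X_ne (by decide)]; exact X_ne_zero _
        all_goals
          rw [Finset.prod_ne_zero_iff]
          intro s' _
          apply ne_of_eval ![0, 1, 0]
          simp [sb]) (by rw [← h]; congr 1; rw [FF]; ring) s hs
    have h2 := hEl _ 0 (hCh _) h1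
    rwa [map_sub, hηC, sub_zero] at h2
  have hB : pB n m ∣ η (X 1) := by
    rw [pB_eq]
    apply prod_dvd_fam (CX_inj n) (fun s s' => sb_lin 1 _ (by decide) _)
    intro s hs
    have h1 := log_fam θ (i := 1) (CX_inj n) (fun s s' => sb_lin 1 _ (by decide) _) (m := m)
      (R := X 2 * (pA n m * pC n m)) (pB_eq n m) (by
        intro s
        rw [map_mul, map_mul, pA_eq, pC_eq, map_prod, map_prod]
        refine mul_ne_zero ?_ (mul_ne_zero ?_ ?_)
        · rw [sb_X_ne (by decide)]; exact X_ne_zero _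
        all_goals
          rw [Finset.prod_ne_zero_iff]
          intro s' _
          apply ne_of_eval ![1, 0, 0]
          simp [sb]) (by rw [← h]; congr 1; rw [FF]; ring) s hs
    have h2 := hEl _ 1 (hCh _) h1
    rwa [map_sub, hηC, sub_zero] at h2
  have hCinj : Function.Injective (fun s => (C (rr n s) * X 2 - X 1 : S)) := by
    intro a b hab
    exact CX_inj n (sub_left_injective hab)
  have hCsb : ∀ s s' : ℕ, sb 0 (C (rr n s) * X 2 - X 1) (C (rr n s') * X 2 - X 1) =
      C (rr n s') * X 2 - X 1 := by
    intro s s'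
    rw [map_sub, sb_lin 0 _ (by decide), sb_X_ne (by decide)]
  have hC : pC n m ∣ η (X 0) + η (X 1) := by
    rw [pC_eq]
    apply prod_dvd_fam hCinj hCsb
    intro s hs
    have h1 := log_fam θ (i := 0) hCinj hCsb (m := m)
      (R := X 2 * (pA n m * pB n m)) (pC_eq n m) (by
        intro s
        rw [map_mul, map_mul, pA_eq, pB_eq, map_prod, map_prod]
        refine mul_ne_zero ?_ (mul_ne_zero ?_ ?_)
        · rw [sb_X_ne (by decide)]; exact X_ne_zero _
        all_goals
          rw [Finset.prod_ne_zero_iff]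
          intro s' _
          apply ne_of_eval ![0, 1, 0]
          simp [sb]) (by rw [← h]; congr 1; rw [FF]; ring) s hs
    have h2 := hEl _ 0 ((hCh _).sub (isHomogeneous_X _ _)) h1
    rwa [map_sub, map_sub, hηC, zero_sub, sub_neg_eq_add] at h2
  obtain ⟨a, ha⟩ := hA
  obtain ⟨b, hb⟩ := hB
  obtain ⟨c, hc⟩ := hC
  have ht : ![a, b, c] ∈ Msyz n m := by
    rw [mem_Msyz]
    change a * pA n m + b * pB n m = c * pC n m
    linear_combination hc - ha - hb
  refine ⟨![a, b, c], ht, ?_⟩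
  have hηeq : eta n m ![a, b, c] = η := by
    apply derivation_ext
    intro i
    rw [eta_apply]
    change a * pA n m * _ + b * pB n m * _ = _
    fin_cases i
    · change _ = η (X 0)
      rw [ha]
      simp [pderiv_X_of_ne]; ring
    · change _ = η (X 1)
      rw [hb]
      simp [pderiv_X_of_ne]; ring
    · change _ = η (X 2)
      rw [hη2]
      simp [pderiv_X_of_ne]
  have hhw : hh n m ![a, b, c] = -w * ((3 * m + 1 : ℕ) : S) := by
    have h1 := eta_FF ht
    rw [hηeq, hηa, h, Eul_hom (FF_hom n m)] at h1
    apply mul_right_cancel₀ (FF_ne (n := n) (m := m))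
    linear_combination -h1
  have hcst : (C ((3 * m + 1 : ℕ) : ℝ)⁻¹ : S) * ((3 * m + 1 : ℕ) : S) = 1 := by
    rw [← map_natCast (C : ℝ →+* S), ← map_mul, inv_mul_cancel₀ (by positivity), map_one]
  apply Derivation.ext
  intro p
  rw [Th_apply, hηeq, hηa, hhw]
  linear_combination w * Eul p * hcst
/-- Theorem 1 (main): for `k ≥ 2`, `j ≥ 0` the logarithmic module `D_0(f_{j,k})` has a
resolution `0 → S(-1)^{k-1} → S^{k+1} → D_0(f_{j,k})(2k+1+3j) → 0`; i.e. the logarithmic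
bundle `T_A(2k+1+3j)` is a Steiner bundle. -/
theorem steiner_resolution_of_A2_deformation (k j : ℕ) (hk : 2 ≤ k) :
    ∃ (θ : Fin (k + 1) → Derivation ℝ S S) (M : Matrix (Fin (k + 1)) (Fin (k - 1)) S),
      (∀ i, θ i ∈ D0 (fjk j k)) ∧
      (∀ i, IsHomogDer (θ i) (2 * k + 1 + 3 * j)) ∧
      (∀ i l, (M i l).IsHomogeneous 1) ∧
      (Set.range (fun a : Fin (k + 1) → S => ∑ i, a i • θ i) = (D0 (fjk j k) : Set (Derivation ℝ S S))) ∧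
      Function.Injective M.mulVec ∧
      (∀ a : Fin (k + 1) → S, (∑ i, a i • θ i) = 0 ↔ ∃ v : Fin (k - 1) → S, M.mulVec v = a) := by
  obtain ⟨t, M, hmem, hhom, hM, hgen, hinj, hker⟩ :=
    core (k + j) (k + 2 * j + 1) j k rfl rfl hk
  have hD : ∀ θ : Derivation ℝ S S, θ ∈ D0 (fjk j k) ↔ θ (FF (k + j) (k + 2 * j + 1)) = 0 := by
    intro θ
    rw [← fjk_eq]
    rfl
  have hsum : ∀ a : Fin (k + 1) → S, ∑ i, a i • Th (k + j) (k + 2 * j + 1) (t i) =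
      Th (k + j) (k + 2 * j + 1) (∑ i, a i • t i) := by
    intro a
    rw [map_sum]
    simp only [map_smul]
  have hcm : ∀ a : Fin (k + 1) → S, ∑ i, a i • t i ∈ Msyz (k + j) (k + 2 * j + 1) :=
    fun a => Submodule.sum_mem _ fun i _ => Submodule.smul_mem _ _ (hmem i)
  refine ⟨fun i => Th (k + j) (k + 2 * j + 1) (t i), M, ?_, ?_, hM, ?_, hinj, ?_⟩
  · intro i
    rw [hD]
    exact Th_mem (hmem i)
  · intro i
    have := Th_hom (m := k + 2 * j + 1) (by omega) (hhom i)
    rwa [show k + j + (k + 2 * j + 1) = 2 * k + 1 + 3 * j by ring] at this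
  · ext θ
    rw [SetLike.mem_coe, hD]
    constructor
    · rintro ⟨a, rfl⟩
      simp only [hsum]
      exact Th_mem (hcm a)
    · intro h
      obtain ⟨s, hs, rfl⟩ := Th_surj θ h
      obtain ⟨a, ha⟩ := hgen s hs
      refine ⟨a, ?_⟩
      simp only [hsum]
      rw [← ha]
  · intro a
    rw [← hker a, hsum]
    constructor
    · exact fun h => Th_inj (hcm a) h
    · intro h
      rw [h, map_zero]
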